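/- arXiv:2403.07686 — 2 statements merged into one kernel-verified Lean document; each statement's English description precedes it below -/
import Mathlib

section
/- Let n ≥ 0, let D^{n+1} ⊆ ℝ^{n+1} be the closed Euclidean unit disk, S^n = ∂D^{n+1} its boundary sphere, and D̊^{n+1} = D^{n+1} \ S^n its interior. Let X be a metrizable topological space. Suppose f : D^{n+1}×{0} ∪ S^n×[0,1] → X and f' : D^{n+1}×[0,1) → X are continuous maps that agree on the overlap D^{n+1}×{0} ∪ S^n×[0,1). Then there exists a continuous map f̃ : D^{n+1}×[0,1] → X whose restriction to D^{n+1}×{0} ∪ S^n×[0,1] equals f, and such that f̃(D̊^{n+1} × [0,1]) ⊆ f'(D̊^{n+1} × [0,1)). -/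
open Set Metric Filter Topology

/-- A compact set `C` meeting `S ×ˢ univ` only at height `1` lies above the graph of a continuous
function which equals `1` on `S` and is less than `1` off `S`. -/
theorem exists_continuous_eq_one_lt_of_isCompact {E : Type*} [PseudoMetricSpace E] {S : Set E}
    (hS : IsClosed S) (hSne : S.Nonempty) {C : Set (E × ℝ)} (hC : IsCompact C)
    (hCne : C.Nonempty) (hC0 : ∀ p ∈ C, 0 ≤ p.2) (hCS : ∀ p ∈ C, p.1 ∈ S → p.2 = 1) :
    ∃ φ : E → ℝ, Continuous φ ∧ (∀ x, 0 ≤ φ x) ∧ (∀ x ∈ S, φ x = 1) ∧ (∀ x ∉ S, φ x < 1) ∧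
      ∀ p ∈ C, p.1 ∉ S → 0 < p.2 → φ p.1 < p.2 := by
  classical
  set d : E → ℝ := fun x => infDist x S with hd
  have hdc : Continuous d := continuous_infDist_pt S
  have hd0 : ∀ x, 0 ≤ d x := fun x => infDist_nonneg
  have hdpos : ∀ x, x ∉ S → 0 < d x := fun x hx => (hS.notMem_iff_infDist_pos hSne).1 hx
  have hdS : ∀ x ∈ S, d x = 0 := fun x hx => infDist_zero_of_mem hx
  set F : E → E × ℝ → ℝ := fun x p => d x * p.2 + dist x p.1 with hF
  set μ : E → ℝ := fun x => sInf (F x '' C) with hμ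
  have hμc : Continuous μ := hC.continuous_sInf (by
    change Continuous fun q : E × (E × ℝ) => d q.1 * q.2.2 + dist q.1 q.2.1
    fun_prop)
  have hμle : ∀ x, ∀ p ∈ C, μ x ≤ F x p := fun x p hp =>
    csInf_le ⟨0, by
      rintro _ ⟨q, hq, rfl⟩
      exact add_nonneg (mul_nonneg (hd0 x) (hC0 q hq)) dist_nonneg⟩ (mem_image_of_mem _ hp)
  have hleμ : ∀ x c, (∀ p ∈ C, c ≤ F x p) → c ≤ μ x := fun x c h =>
    le_csInf (hCne.image _) (by rintro _ ⟨q, hq, rfl⟩; exact h q hq)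
  set φ : E → ℝ := fun x => if x ∈ S then 1 else max 0 (min 1 (μ x / d x) - d x) with hφ
  have hφS : ∀ x ∈ S, φ x = 1 := fun x hx => if_pos hx
  have hφn : ∀ x ∉ S, φ x = max 0 (min 1 (μ x / d x) - d x) := fun x hx => if_neg hx
  have hφlt : ∀ x ∉ S, φ x < 1 := fun x hx => by
    rw [hφn x hx]
    have := min_le_left 1 (μ x / d x)
    exact max_lt one_pos (by linarith [hdpos x hx])
  refine ⟨φ, ?_, fun x => ?_, hφS, hφlt, fun p hp hpS hp0 => ?_⟩
  · rw [continuous_iff_continuousAt]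
    intro x
    by_cases hx : x ∈ S
    · rw [ContinuousAt, hφS x hx, tendsto_order]
      refine ⟨fun a ha => ?_, fun a ha => Eventually.of_forall fun y => ?_⟩
      · obtain ⟨ε, hε, hε'⟩ : ∃ ε : ℝ, 0 < ε ∧ a < 1 - 2 * ε :=
          ⟨(1 - a) / 4, by linarith, by linarith⟩
        obtain ⟨δ, hδ, hδC⟩ : ∃ δ : ℝ, 0 < δ ∧ ∀ p ∈ C, p.2 ≤ 1 - ε → δ ≤ d p.1 := by
          have hK : IsCompact (C ∩ {p | p.2 ≤ 1 - ε}) :=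
            hC.inter_right (isClosed_le continuous_snd continuous_const)
          obtain ⟨δ, hδ, h⟩ := hK.exists_forall_le' (f := fun p : E × ℝ => d p.1) (a := 0)
            (hdc.comp continuous_fst).continuousOn fun p hp => hdpos _ fun hpS => by
              have h1 := hCS p hp.1 hpS
              have h2 : p.2 ≤ 1 - ε := hp.2
              linarith
          exact ⟨δ, hδ, fun p hp hpε => h p ⟨hp, hpε⟩⟩
        have hev : ∀ᶠ y in 𝓝 x, d y < min (δ / 2) ε :=
          hdc.continuousAt.eventually_lt_const (by rw [hdS x hx]; positivity)
        filter_upwards [hev] with y hy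
        by_cases hyS : y ∈ S
        · rw [hφS y hyS]; exact ha
        rw [hφn y hyS]
        have hy1 := hy.trans_le (min_le_left _ _)
        have hy2 := hy.trans_le (min_le_right _ _)
        have hyd := hdpos y hyS
        have hμy : (1 - ε) * d y ≤ μ y := hleμ _ _ fun p hp => by
          have hdist : 0 ≤ dist y p.1 := dist_nonneg
          rcases le_total p.2 (1 - ε) with h | h
          · have h1 := hδC p hp h
            have h2 : d p.1 ≤ d y + dist p.1 y := infDist_le_infDist_add_dist
            rw [dist_comm] at h2
            have h3 := mul_nonneg hyd.le (hC0 p hp)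
            simp only [hF]
            nlinarith
          · simp only [hF]
            nlinarith
        have h1 : 1 - ε ≤ min 1 (μ y / d y) :=
          le_min (by linarith) ((le_div_iff₀ hyd).2 hμy)
        exact lt_max_of_lt_right (by linarith)
      · by_cases hyS : y ∈ S
        · rw [hφS y hyS]; exact ha
        · exact (hφlt y hyS).trans ha
    · have hev : φ =ᶠ[𝓝 x] fun y => max 0 (min 1 (μ y / d y) - d y) := by
        filter_upwards [hS.isOpen_compl.mem_nhds hx] with y hy using hφn y hy
      refine ContinuousAt.congr ?_ hev.symm
      have := (hμc.continuousAt (x := x)).div hdc.continuousAt (hdpos x hx).ne'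
      exact continuousAt_const.max ((continuousAt_const.min this).sub hdc.continuousAt)
  · by_cases hx : x ∈ S
    · rw [hφS x hx]; exact zero_le_one
    · rw [hφn x hx]; exact le_max_left _ _
  · rw [hφn _ hpS]
    have hdp := hdpos _ hpS
    have h1 : μ p.1 / d p.1 ≤ p.2 := by
      rw [div_le_iff₀ hdp]
      have := hμle p.1 p hp
      simp only [hF, dist_self] at this
      linarith
    have h2 := min_le_right 1 (μ p.1 / d p.1)
    exact max_lt hp0 (by linarith)

/-- **Extension lemma.** Let `n ≥ 0`, let `D^{n+1} ⊆ ℝ^{n+1}` be the closed Euclidean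
unit disk, `S^n` its boundary sphere, and `D̊^{n+1}` its interior. Let `X` be a
metrizable topological space. Suppose `f` is continuous on
`D^{n+1} × {0} ∪ S^n × [0,1]` and `f'` is continuous on `D^{n+1} × [0,1)`, and they
agree on the overlap `D^{n+1} × {0} ∪ S^n × [0,1)`. Then there is a map `g`,
continuous on `D^{n+1} × [0,1]`, restricting to `f` on `D^{n+1} × {0} ∪ S^n × [0,1]`,
and with `g (D̊^{n+1} × [0,1]) ⊆ f' (D̊^{n+1} × [0,1))`. -/
theorem extension_lemma (n : ℕ) (X : Type*) [TopologicalSpace X]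
    [TopologicalSpace.MetrizableSpace X]
    (f f' : EuclideanSpace ℝ (Fin (n + 1)) × ℝ → X)
    (hf : ContinuousOn f
      ((closedBall (0 : EuclideanSpace ℝ (Fin (n + 1))) 1) ×ˢ ({0} : Set ℝ) ∪
        (sphere (0 : EuclideanSpace ℝ (Fin (n + 1))) 1) ×ˢ Icc (0 : ℝ) 1))
    (hf' : ContinuousOn f'
      ((closedBall (0 : EuclideanSpace ℝ (Fin (n + 1))) 1) ×ˢ Ico (0 : ℝ) 1))
    (hagree : EqOn f f'
      ((closedBall (0 : EuclideanSpace ℝ (Fin (n + 1))) 1) ×ˢ ({0} : Set ℝ) ∪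
        (sphere (0 : EuclideanSpace ℝ (Fin (n + 1))) 1) ×ˢ Ico (0 : ℝ) 1)) :
    ∃ g : EuclideanSpace ℝ (Fin (n + 1)) × ℝ → X,
      ContinuousOn g ((closedBall (0 : EuclideanSpace ℝ (Fin (n + 1))) 1) ×ˢ Icc (0 : ℝ) 1) ∧
      EqOn g f
        ((closedBall (0 : EuclideanSpace ℝ (Fin (n + 1))) 1) ×ˢ ({0} : Set ℝ) ∪
          (sphere (0 : EuclideanSpace ℝ (Fin (n + 1))) 1) ×ˢ Icc (0 : ℝ) 1) ∧
      g '' ((ball (0 : EuclideanSpace ℝ (Fin (n + 1))) 1) ×ˢ Icc (0 : ℝ) 1) ⊆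
        f' '' ((ball (0 : EuclideanSpace ℝ (Fin (n + 1))) 1) ×ˢ Ico (0 : ℝ) 1) := by
  classical
  let _ : MetricSpace X := TopologicalSpace.metrizableSpaceMetric X
  set D := closedBall (0 : EuclideanSpace ℝ (Fin (n + 1))) 1 with hD
  set S := sphere (0 : EuclideanSpace ℝ (Fin (n + 1))) 1 with hS
  have hSD : S ⊆ D := sphere_subset_closedBall
  have hfr : ∀ x ∈ S, ∀ t ∈ Icc (0 : ℝ) 1, ∀ B ⊆ univ ×ˢ Icc (0 : ℝ) 1,
      ContinuousWithinAt (fun p : EuclideanSpace ℝ (Fin (n + 1)) × ℝ => f (‖p.1‖⁻¹ • p.1, p.2))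
        B (x, t) := by
    intro x hx t ht B hB
    have hx1 : ‖x‖ = 1 := by simpa [hS] using hx
    have hx0 : x ≠ 0 := norm_ne_zero_iff.1 (by rw [hx1]; exact one_ne_zero)
    have hr : ContinuousAt (fun p : EuclideanSpace ℝ (Fin (n + 1)) × ℝ => (‖p.1‖⁻¹ • p.1, p.2))
        (x, t) :=
      ((continuousAt_fst.norm.inv₀ (norm_ne_zero_iff.2 hx0)).smul continuousAt_fst).prodMk
        continuousAt_snd
    have hfx := (hf (x, t) (Or.inr ⟨hx, ht⟩))
    have hval : (‖x‖⁻¹ • x, t) = (x, t) := by rw [hx1, inv_one, one_smul]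
    rw [ContinuousWithinAt]
    simp only [hval]
    refine hfx.tendsto.comp (tendsto_nhdsWithin_iff.2 ⟨?_, ?_⟩)
    · have := hr.tendsto.mono_left (nhdsWithin_le_nhds (s := B))
      simpa only [hval] using this
    · have hne : ∀ᶠ p : EuclideanSpace ℝ (Fin (n + 1)) × ℝ in 𝓝[B] (x, t), p.1 ≠ 0 :=
        (continuousAt_fst.eventually_ne hx0).filter_mono nhdsWithin_le_nhds
      filter_upwards [hne, self_mem_nhdsWithin] with p hp hpB
      refine Or.inr ⟨?_, (hB hpB).2⟩
      simp [hS, norm_smul, norm_ne_zero_iff.2 hp]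
  set B : Set (EuclideanSpace ℝ (Fin (n + 1)) × ℝ) :=
    {p | p ∈ D ×ˢ Icc (0 : ℝ) 1 ∧ 1 - p.2 ≤ dist (f' p) (f (‖p.1‖⁻¹ • p.1, p.2))} with hB
  have hcpt : IsCompact (D ×ˢ Icc (0 : ℝ) 1) := (isCompact_closedBall _ _).prod isCompact_Icc
  have hBsub : closure B ⊆ D ×ˢ Icc (0 : ℝ) 1 :=
    closure_minimal (fun p hp => hp.1) hcpt.isClosed
  have hCS : ∀ p ∈ closure B, p.1 ∈ S → p.2 = 1 := by
    rintro ⟨x, t⟩ hp hx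
    have ht := (hBsub hp).2
    by_contra hne
    have ht1 : t < 1 := lt_of_le_of_ne ht.2 hne
    have hx1 : ‖x‖ = 1 := by simpa [hS] using hx
    have hnb : D ×ˢ Ico (0 : ℝ) 1 ∈ 𝓝[B] (x, t) := by
      have : ∀ᶠ p : EuclideanSpace ℝ (Fin (n + 1)) × ℝ in 𝓝[B] (x, t), p.2 < 1 :=
        ((continuous_snd.tendsto (x, t)).eventually_lt_const ht1).filter_mono nhdsWithin_le_nhds
      filter_upwards [this, self_mem_nhdsWithin] with q hq hqB
      exact ⟨hqB.1.1, hqB.1.2.1, hq⟩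
    have h1 : ContinuousWithinAt f' B (x, t) :=
      (hf' (x, t) ⟨hSD hx, ht.1, ht1⟩).mono_of_mem_nhdsWithin hnb
    have h2 := hfr x hx t ht B fun q hq => ⟨mem_univ _, hq.1.2⟩
    have h3 : ContinuousWithinAt (fun p : EuclideanSpace ℝ (Fin (n + 1)) × ℝ => 1 - p.2)
        B (x, t) := by fun_prop
    have : (𝓝[B] (x, t)).NeBot := mem_closure_iff_nhdsWithin_neBot.1 hp
    have h4 := le_of_tendsto_of_tendsto h3.tendsto (h1.tendsto.dist h2.tendsto)
      (eventually_mem_nhdsWithin.mono fun q hq => hq.2)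
    have h5 : f (x, t) = f' (x, t) := hagree (Or.inr ⟨hx, ht.1, ht1⟩)
    simp only [hx1, inv_one, one_smul, h5, dist_self] at h4
    linarith
  have hB1 : ∀ x ∈ D, (x, (1 : ℝ)) ∈ B := fun x hx => by
    refine ⟨⟨hx, zero_le_one, le_rfl⟩, ?_⟩
    simp only [sub_self]
    exact dist_nonneg
  obtain ⟨φ, hφc, hφ0, hφS, hφlt, hφB⟩ := exists_continuous_eq_one_lt_of_isCompact
    (S := S) (C := closure B) isClosed_sphere (NormedSpace.sphere_nonempty.2 zero_le_one)
    (hcpt.of_isClosed_subset isClosed_closure hBsub)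
    ⟨(0, 1), subset_closure (hB1 0 (by simp [hD]))⟩ (fun p hp => (hBsub hp).2.1) hCS
  set F : EuclideanSpace ℝ (Fin (n + 1)) × ℝ → X := fun p => if p.2 < 1 then f' p else f p with hF
  set A : Set (EuclideanSpace ℝ (Fin (n + 1)) × ℝ) :=
    {p | p ∈ D ×ˢ Icc (0 : ℝ) 1 ∧ p.2 ≤ φ p.1} with hA
  have hFc : ContinuousOn F A := by
    rintro ⟨x, t⟩ ⟨⟨hx, ht⟩, htφ⟩
    simp only at hx ht htφ
    rcases ht.2.lt_or_eq with ht1 | rfl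
    · have hlt : ∀ᶠ p : EuclideanSpace ℝ (Fin (n + 1)) × ℝ in 𝓝[A] (x, t), p.2 < 1 :=
        ((continuous_snd.tendsto (x, t)).eventually_lt_const ht1).filter_mono nhdsWithin_le_nhds
      have hnb : D ×ˢ Ico (0 : ℝ) 1 ∈ 𝓝[A] (x, t) := by
        filter_upwards [hlt, self_mem_nhdsWithin] with q hq hqA
        exact ⟨hqA.1.1, hqA.1.2.1, hq⟩
      exact ((hf' (x, t) ⟨hx, ht.1, ht1⟩).mono_of_mem_nhdsWithin hnb).congr_of_eventuallyEq
        (hlt.mono fun q hq => if_pos hq) (if_pos ht1)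
    · have hxS : x ∈ S := by
        by_contra h
        exact (hφlt x h).not_ge htφ
      have hx1 : ‖x‖ = 1 := by simpa [hS] using hxS
      have h2 := (hfr x hxS 1 ht A fun q hq => ⟨mem_univ _, hq.1.2⟩).tendsto
      have hFx : F (x, 1) = f (‖x‖⁻¹ • x, 1) := by
        rw [hx1, inv_one, one_smul]
        exact if_neg (lt_irrefl _)
      rw [ContinuousWithinAt, hFx]
      have h3 : Tendsto (fun p : EuclideanSpace ℝ (Fin (n + 1)) × ℝ => 1 - p.2)
          (𝓝[A] (x, 1)) (𝓝 0) := by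
        have : ContinuousWithinAt (fun p : EuclideanSpace ℝ (Fin (n + 1)) × ℝ => 1 - p.2)
          A (x, 1) := by fun_prop
        simpa using this.tendsto
      refine h2.congr_dist (squeeze_zero' (Eventually.of_forall fun _ => dist_nonneg) ?_ h3)
      have hpos : ∀ᶠ p : EuclideanSpace ℝ (Fin (n + 1)) × ℝ in 𝓝[A] (x, 1), 0 < p.2 :=
        ((continuous_snd.tendsto (x, (1 : ℝ))).eventually_const_lt one_pos).filter_mono
          nhdsWithin_le_nhds
      filter_upwards [hpos, self_mem_nhdsWithin] with q hq0 hqA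
      rw [dist_comm]
      by_cases hqS : q.1 ∈ S
      · have hq1 : ‖q.1‖ = 1 := by simpa [hS] using hqS
        have : F q = f q := by
          by_cases h : q.2 < 1
          · rw [hF]
            simp only [h, if_true]
            exact (hagree (Or.inr ⟨hqS, hqA.1.2.1, h⟩)).symm
          · exact if_neg h
        rw [this, hq1, inv_one, one_smul, dist_self]
        linarith [hqA.1.2.2]
      · have hqB : q ∉ B := fun h =>
          (hφB q (subset_closure h) hqS hq0).not_ge hqA.2
        have hlt : q.2 < 1 := hqA.2.trans_lt (hφlt _ hqS)
        have : F q = f' q := if_pos hlt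
        rw [this]
        by_contra! h
        exact hqB ⟨hqA.1, h.le⟩
  refine ⟨fun p => F (p.1, min p.2 (φ p.1)), ?_, ?_, ?_⟩
  · refine hFc.comp (f := fun p : EuclideanSpace ℝ (Fin (n + 1)) × ℝ => (p.1, min p.2 (φ p.1)))
      (by fun_prop) ?_
    rintro ⟨x, t⟩ ⟨hx, ht⟩
    exact ⟨⟨hx, le_min ht.1 (hφ0 x), (min_le_left _ _).trans ht.2⟩, min_le_right _ _⟩
  · rintro ⟨x, t⟩ (⟨hx, ht⟩ | ⟨hx, ht⟩)
    · obtain rfl : t = 0 := ht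
      simp only [min_eq_left (hφ0 x), hF, zero_lt_one, if_true]
      exact (hagree (Or.inl ⟨hx, rfl⟩)).symm
    · simp only [hφS x hx, min_eq_left ht.2, hF]
      split_ifs with h
      · exact (hagree (Or.inr ⟨hx, ht.1, h⟩)).symm
      · rfl
  · rintro _ ⟨⟨x, t⟩, ⟨hx, ht⟩, rfl⟩
    have hxS : x ∉ S := fun h => (ne_of_lt hx) h
    have hlt : min t (φ x) < 1 := (min_le_right _ _).trans_lt (hφlt x hxS)
    exact ⟨(x, min t (φ x)), ⟨hx, le_min ht.1 (hφ0 x), hlt⟩, (if_pos hlt).symm⟩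
end

section
/- Let X be a metrizable stratified space over a poset P. Then the following are equivalent: (1) X is categorically fibrant; (2) X is diagrammatically fibrant; (3) for every pair p < q in P, the starting-point evaluation map ev₀ : Holink_{p<q}(X) → X_p is a Serre fibration; (4) for every pair p < q in P and all integers n, k with 1 ≤ k < n, X has the horn filling property for the pair (J,k), where J = [p_0 ≤ … ≤ p_n] is the flag with p_i = p for 0 ≤ i ≤ k and p_i = q for k < i ≤ n. -/
open Set unitInterval

noncomputable section

/-! ### Stratified spaces over a poset -/

/-- Continuity into the Alexandrov topology on a preordered set: preimages of
upper sets are open. -/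
def AlexContinuous {P : Type*} [Preorder P] {X : Type*} [TopologicalSpace X] (s : X → P) : Prop :=
  ∀ U : Set P, IsUpperSet U → IsOpen (s ⁻¹' U)

lemma stdSimplex.exists_pos' {n : ℕ} (x : stdSimplex ℝ (Fin (n + 1))) :
    ∃ i, 0 < (x : Fin (n + 1) → ℝ) i := by
  by_contra h
  push_neg at h
  have h1 : ∑ i, (x : Fin (n + 1) → ℝ) i = 1 := x.2.2
  have h2 : ∑ i, (x : Fin (n + 1) → ℝ) i ≤ 0 := Finset.sum_nonpos fun i _ => h i
  linarith

/-- The largest index with positive barycentric coordinate. -/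
def maxSupp {n : ℕ} (x : stdSimplex ℝ (Fin (n + 1))) : Fin (n + 1) :=
  (Finset.univ.filter fun i => 0 < (x : Fin (n + 1) → ℝ) i).max' (by
    obtain ⟨i, hi⟩ := stdSimplex.exists_pos' x
    exact ⟨i, Finset.mem_filter.2 ⟨Finset.mem_univ i, hi⟩⟩)

/-- The stratification of the realized stratified simplex `|Δ^J|` of a flag `J`. -/
def flagStrat {P : Type*} {n : ℕ} (J : Fin (n + 1) → P) (x : stdSimplex ℝ (Fin (n + 1))) : P :=
  J (maxSupp x)

/-- The `k`-th horn of the standard `n`-simplex, as a subset of the simplex. -/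
def hornSet (n : ℕ) (k : Fin (n + 1)) : Set (stdSimplex ℝ (Fin (n + 1))) :=
  {x | ∃ i, i ≠ k ∧ (x : Fin (n + 1) → ℝ) i = 0}

/-- `X` (stratified by `s`) has the horn filling property with respect to the
realized stratified horn inclusion `|Λ^J_k| ↪ |Δ^J|`. -/
def HornFilling {P : Type*} {X : Type*} [TopologicalSpace X] (s : X → P) {n : ℕ}
    (J : Fin (n + 1) → P) (k : Fin (n + 1)) : Prop :=
  ∀ f : hornSet n k → X, Continuous f →
    (∀ y : hornSet n k, s (f y) = flagStrat J y.1) →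
    ∃ g : stdSimplex ℝ (Fin (n + 1)) → X, Continuous g ∧
      (∀ x, s (g x) = flagStrat J x) ∧ ∀ y : hornSet n k, g y.1 = f y

/-- `(J, k)` is an inner horn datum. -/
def IsInner (n : ℕ) (k : Fin (n + 1)) : Prop := 0 < (k : ℕ) ∧ (k : ℕ) < n

/-- `(J, k)` is an admissible horn datum. -/
def IsAdmissible {P : Type*} {n : ℕ} (J : Fin (n + 1) → P) (k : Fin (n + 1)) : Prop :=
  IsInner n k ∨
    ((k : ℕ) = 0 ∧ ∃ h : 0 < n, J ⟨0, Nat.succ_pos n⟩ = J ⟨1, Nat.succ_lt_succ h⟩) ∨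
    ((k : ℕ) = n ∧ ∃ _h : 0 < n, J ⟨n - 1, by omega⟩ = J ⟨n, Nat.lt_succ_self n⟩)

/-- A stratified space is categorically fibrant if it has the horn filling property
with respect to all inner stratified horn inclusions. -/
def CatFibrant {P : Type*} [Preorder P] {X : Type*} [TopologicalSpace X] (s : X → P) : Prop :=
  ∀ (n : ℕ) (J : Fin (n + 1) → P), Monotone J → ∀ k : Fin (n + 1), IsInner n k → HornFilling s J k

/-- A stratified space is diagrammatically fibrant if it has the horn filling property
with respect to all admissible stratified horn inclusions. -/
def DiagFibrant {P : Type*} [Preorder P] {X : Type*} [TopologicalSpace X] (s : X → P) : Prop :=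
  ∀ (n : ℕ) (J : Fin (n + 1) → P), Monotone J → ∀ k : Fin (n + 1), IsAdmissible J k →
    HornFilling s J k

/-! ### Exit paths and refinedness -/

/-- An exit path: `s ∘ γ` is constant on `(0, 1]` and does not decrease from `γ 0`. -/
def IsExitPath {P : Type*} [Preorder P] {X : Type*} [TopologicalSpace X]
    (s : X → P) (γ : C(I, X)) : Prop :=
  (∀ t t' : I, t ≠ 0 → t' ≠ 0 → s (γ t) = s (γ t')) ∧ ∀ t : I, s (γ 0) ≤ s (γ t)

/-- One step in a chain of exit paths. -/
def ExitStep {P : Type*} [Preorder P] {X : Type*} [TopologicalSpace X] (s : X → P)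
    (x y : X) : Prop :=
  ∃ γ : C(I, X), IsExitPath s γ ∧ γ 0 = x ∧ γ 1 = y

/-- A stratified space is refined if its stratification is surjective and the order
relation is exactly detected by finite chains of exit paths. -/
def IsRefined {P : Type*} [Preorder P] {X : Type*} [TopologicalSpace X] (s : X → P) : Prop :=
  Function.Surjective s ∧ ∀ x y : X, s x ≤ s y ↔ Relation.ReflTransGen (ExitStep s) x y

/-- The frontier relation: the `p`-stratum meets the closure of the `q`-stratum. -/
def FrontierRel {P : Type*} {X : Type*} [TopologicalSpace X] (s : X → P) (p q : P) : Prop :=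
  (s ⁻¹' {p} ∩ closure (s ⁻¹' {q})).Nonempty

/-- Weakly frontier stratified. -/
def WeaklyFrontierStratified {P : Type*} [Preorder P] {X : Type*} [TopologicalSpace X]
    (s : X → P) : Prop :=
  Function.Surjective s ∧ ∀ p q : P, p ≤ q ↔ Relation.ReflTransGen (FrontierRel s) p q

/-- Frontier stratified. -/
def FrontierStratified {P : Type*} [Preorder P] {X : Type*} [TopologicalSpace X]
    (s : X → P) : Prop :=
  WeaklyFrontierStratified s ∧ ∀ p q : P, FrontierRel s p q → s ⁻¹' {p} ⊆ closure (s ⁻¹' {q})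

/-! ### Homotopy links -/

lemma I_one_ne_zero : (1 : I) ≠ 0 := fun h => one_ne_zero (α := ℝ) (congrArg Subtype.val h)

/-- The pairwise homotopy link of the pair of strata `p`, `q`. -/
abbrev PairHolink {P : Type*} {X : Type*} [TopologicalSpace X] (s : X → P) (p q : P) :=
  {γ : C(I, X) // s (γ 0) = p ∧ ∀ t : I, t ≠ 0 → s (γ t) = q}

/-- Starting point evaluation on the pairwise homotopy link. -/
def pairHolinkEv0 {P : Type*} {X : Type*} [TopologicalSpace X] (s : X → P) (p q : P)
    (γ : PairHolink s p q) : {x : X // s x = p} :=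
  ⟨γ.1 0, γ.2.1⟩

/-- A Serre fibration: a map with the homotopy lifting property with respect to all
Euclidean disks. -/
def IsSerreFibration {E B : Type*} [TopologicalSpace E] [TopologicalSpace B] (π : E → B) : Prop :=
  ∀ (n : ℕ)
    (H : ↥(Metric.closedBall (0 : EuclideanSpace ℝ (Fin n)) 1) × I → B)
    (h₀ : ↥(Metric.closedBall (0 : EuclideanSpace ℝ (Fin n)) 1) → E),
    Continuous H → Continuous h₀ → (∀ d, π (h₀ d) = H (d, 0)) →
    ∃ G : ↥(Metric.closedBall (0 : EuclideanSpace ℝ (Fin n)) 1) × I → E,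
      Continuous G ∧ (∀ d, G (d, 0) = h₀ d) ∧ ∀ z, π (G z) = H z

/-- The stratified homotopy link of the stratum `p`: exit paths starting in the
`p`-stratum and immediately leaving it. -/
abbrev StratHolink {P : Type*} [Preorder P] {X : Type*} [TopologicalSpace X]
    (s : X → P) (p : P) :=
  {γ : C(I, X) // s (γ 0) = p ∧ (∀ t : I, t ≠ 0 → p < s (γ t)) ∧
    ∀ t t' : I, t ≠ 0 → t' ≠ 0 → s (γ t) = s (γ t')}

/-- The stratification of the stratified homotopy link over `P_{>p}`. -/
def stratHolinkStrat {P : Type*} [Preorder P] {X : Type*} [TopologicalSpace X]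
    (s : X → P) (p : P) (γ : StratHolink s p) : {q : P // p < q} :=
  ⟨s (γ.1 1), γ.2.2.1 1 I_one_ne_zero⟩

/-- Endpoint evaluation on the stratified homotopy link. -/
def stratHolinkEv1 {P : Type*} [Preorder P] {X : Type*} [TopologicalSpace X]
    (s : X → P) (p : P) (γ : StratHolink s p) : {x : X // p < s x} :=
  ⟨γ.1 1, γ.2.2.1 1 I_one_ne_zero⟩

/-- The generalized homotopy link of a (regular) flag `Iflag`: the space of stratified
maps `|Δ^Iflag| → X`, topologized via the compact-open topology. -/
abbrev Holink {P : Type*} {X : Type*} [TopologicalSpace X] (s : X → P) {m : ℕ}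
    (Iflag : Fin (m + 1) → P) :=
  {f : C(stdSimplex ℝ (Fin (m + 1)), X) // ∀ x, s (f x) = flagStrat Iflag x}

/-! ### Weak homotopy equivalences -/

/-- The boundary of the `n`-cube. -/
def cubeBoundary (n : ℕ) : Set (Fin n → I) := {y | ∃ i, y i = 0 ∨ y i = 1}

/-- Generalized loops: maps of the `n`-cube collapsing the boundary to the basepoint. -/
abbrev GenLoops (n : ℕ) (X : Type*) [TopologicalSpace X] (x : X) :=
  {p : C((Fin n → I), X) // ∀ y ∈ cubeBoundary n, p y = x}

/-- Homotopy rel boundary as a setoid on generalized loops. -/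
def genLoopSetoid (n : ℕ) (X : Type*) [TopologicalSpace X] (x : X) :
    Setoid (GenLoops n X x) where
  r p q := p.1.HomotopicRel q.1 (cubeBoundary n)
  iseqv := ⟨fun p => ContinuousMap.HomotopicRel.refl p.1,
    fun h => h.symm, fun h h' => h.trans h'⟩

/-- The `n`-th homotopy group (as a type) of `X` at `x`. -/
def HtpyGroup (n : ℕ) (X : Type*) [TopologicalSpace X] (x : X) :=
  Quotient (genLoopSetoid n X x)

/-- The map induced by a continuous map on homotopy groups. -/
def htpyGroupMap (n : ℕ) {X Y : Type*} [TopologicalSpace X] [TopologicalSpace Y]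
    (f : C(X, Y)) (x : X) : HtpyGroup n X x → HtpyGroup n Y (f x) :=
  Quotient.map (fun p => ⟨f.comp p.1, fun y hy => by
      simp [ContinuousMap.comp_apply, p.2 y hy]⟩)
    (fun p q h => h.map fun F => F.compContinuousMap f)

/-- The map induced by a continuous map on path components. -/
def pi0Map {X Y : Type*} [TopologicalSpace X] [TopologicalSpace Y] (f : C(X, Y)) :
    ZerothHomotopy X → ZerothHomotopy Y :=
  Quotient.map f fun _ _ h => ⟨h.somePath.map f.continuous⟩

/-- A weak homotopy equivalence: a continuous map inducing a bijection on path
components and isomorphisms on all homotopy groups at all basepoints. -/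
def IsWeakHomotopyEquiv {X Y : Type*} [TopologicalSpace X] [TopologicalSpace Y]
    (f : C(X, Y)) : Prop :=
  Function.Bijective (pi0Map f) ∧
    ∀ (n : ℕ) (x : X), Function.Bijective (htpyGroupMap (n + 1) f x)

/-! ### Induced maps and diagrammatic equivalences -/

/-- The map induced on generalized homotopy links by a stratified map. -/
def holinkCMap {P : Type*} {X Y : Type*} [TopologicalSpace X] [TopologicalSpace Y]
    (sX : X → P) (sY : Y → P) (w : C(X, Y)) (hw : ∀ x, sY (w x) = sX x)
    {m : ℕ} (Iflag : Fin (m + 1) → P) :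
    C(Holink sX Iflag, Holink sY Iflag) :=
  ⟨fun f => ⟨w.comp f.1, fun x => by simp [ContinuousMap.comp_apply, hw, f.2 x]⟩,
    Continuous.subtype_mk
      ((ContinuousMap.continuous_postcomp w).comp continuous_subtype_val) _⟩

/-- A stratified map is a diagrammatic equivalence if it induces weak homotopy
equivalences on all generalized homotopy links. -/
def IsDiagEquiv {P : Type*} [Preorder P] {X Y : Type*} [TopologicalSpace X] [TopologicalSpace Y]
    (sX : X → P) (sY : Y → P) (w : C(X, Y)) (hw : ∀ x, sY (w x) = sX x) : Prop :=
  ∀ (m : ℕ) (Iflag : Fin (m + 1) → P), StrictMono Iflag →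
    IsWeakHomotopyEquiv (holinkCMap sX sY w hw Iflag)

/-- The restriction of a stratified map to the `q`-stratum. -/
def stratumCMap {Q : Type*} {X Y : Type*} [TopologicalSpace X] [TopologicalSpace Y]
    (sX : X → Q) (sY : Y → Q) (w : C(X, Y)) (hw : ∀ x, sY (w x) = sX x) (q : Q) :
    C({x : X // sX x = q}, {y : Y // sY y = q}) :=
  ⟨fun x => ⟨w x.1, by rw [hw x.1]; exact x.2⟩,
    Continuous.subtype_mk (w.continuous.comp continuous_subtype_val)
      fun x => by show sY (w x.1) = q; rw [hw x.1]; exact x.2⟩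

/-- The map induced on stratified homotopy links by a stratified map. -/
def stratHolinkCMap {P : Type*} [Preorder P] {X Y : Type*} [TopologicalSpace X]
    [TopologicalSpace Y] {sX : X → P} {sY : Y → P} (w : C(X, Y))
    (hw : ∀ x, sY (w x) = sX x) (p : P) :
    C(StratHolink sX p, StratHolink sY p) :=
  ⟨fun γ => ⟨w.comp γ.1,
      by simpa [ContinuousMap.comp_apply, hw] using γ.2.1,
      fun t ht => by simpa [ContinuousMap.comp_apply, hw] using γ.2.2.1 t ht,
      fun t t' ht ht' => by simpa [ContinuousMap.comp_apply, hw] using γ.2.2.2 t t' ht ht'⟩,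
    Continuous.subtype_mk
      ((ContinuousMap.continuous_postcomp w).comp continuous_subtype_val) _⟩

lemma stratHolinkCMap_strat {P : Type*} [Preorder P] {X Y : Type*} [TopologicalSpace X]
    [TopologicalSpace Y] {sX : X → P} {sY : Y → P} (w : C(X, Y))
    (hw : ∀ x, sY (w x) = sX x) (p : P) (γ : StratHolink sX p) :
    stratHolinkStrat sY p (stratHolinkCMap w hw p γ) = stratHolinkStrat sX p γ :=
  Subtype.ext (hw _)

/-- The local homotopy link of `X` at `x ∈ X_p`: the fiber of the stratified homotopy
link over `x`. -/
abbrev LocalHolink {P : Type*} [Preorder P] {X : Type*} [TopologicalSpace X]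
    (s : X → P) (p : P) (x : X) :=
  {γ : StratHolink s p // (γ.1 : C(I, X)) 0 = x}

/-- The stratification of the local homotopy link over `P_{>p}`. -/
def localHolinkStrat {P : Type*} [Preorder P] {X : Type*} [TopologicalSpace X]
    (s : X → P) (p : P) (x : X) (γ : LocalHolink s p x) : {q : P // p < q} :=
  stratHolinkStrat s p γ.1

/-- The map induced on local homotopy links by a stratified map. -/
def localHolinkCMap {P : Type*} [Preorder P] {X Y : Type*} [TopologicalSpace X]
    [TopologicalSpace Y] {sX : X → P} {sY : Y → P} (w : C(X, Y))
    (hw : ∀ x, sY (w x) = sX x) (p : P) (x : X) :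
    C(LocalHolink sX p x, LocalHolink sY p (w x)) :=
  ⟨fun γ => ⟨stratHolinkCMap w hw p γ.1, by
      show (w.comp γ.1.1) 0 = w x
      simp [ContinuousMap.comp_apply, γ.2]⟩,
    Continuous.subtype_mk
      ((stratHolinkCMap w hw p).continuous.comp continuous_subtype_val)
      fun γ => by
        show (w.comp γ.1.1) 0 = w x
        simp [ContinuousMap.comp_apply, γ.2]⟩

lemma localHolinkCMap_strat {P : Type*} [Preorder P] {X Y : Type*} [TopologicalSpace X]
    [TopologicalSpace Y] {sX : X → P} {sY : Y → P} (w : C(X, Y))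
    (hw : ∀ x, sY (w x) = sX x) (p : P) (x : X) (γ : LocalHolink sX p x) :
    localHolinkStrat sY p (w x) (localHolinkCMap w hw p x γ) = localHolinkStrat sX p x γ :=
  Subtype.ext (hw _)

end

theorem Convex.exists_continuous_retraction {F : Type*} [NormedAddCommGroup F]
    [InnerProductSpace ℝ F] [CompleteSpace F] {K : Set F} (hne : K.Nonempty)
    (hcl : IsClosed K) (hconv : Convex ℝ K) :
    ∃ R : F → F, Continuous R ∧ (∀ x, R x ∈ K) ∧ ∀ x ∈ K, R x = x := by
  choose R hRK hR using exists_norm_eq_iInf_of_complete_convex hne hcl.isComplete hconv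
  have key : ∀ u, ∀ w ∈ K, inner ℝ (u - R u) (w - R u) ≤ 0 := fun u =>
    (norm_eq_iInf_iff_real_inner_le_zero hconv (hRK u)).1 (hR u)
  refine ⟨R, ?_, hRK, fun x hx => ?_⟩
  · have : LipschitzWith 1 R := by
      refine LipschitzWith.of_dist_le_mul fun x y => ?_
      rw [NNReal.coe_one, one_mul, dist_eq_norm, dist_eq_norm]
      have h1 := key x (R y) (hRK y)
      have h2 := key y (R x) (hRK x)
      have h3 : inner ℝ (R x - R y) (R x - R y) ≤ inner ℝ (x - y) (R x - R y) := by
        have e1 : x - y = (x - R x) + (R x - R y) - (y - R y) := by abel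
        have e2 : R y - R x = -(R x - R y) := by abel
        rw [e2, inner_neg_right] at h1
        rw [e1, inner_sub_left (x - R x + (R x - R y)), inner_add_left]
        linarith
      rw [real_inner_self_eq_norm_sq] at h3
      have h4 := h3.trans (real_inner_le_norm _ _)
      by_contra! hlt
      have : 0 < ‖R x - R y‖ := (norm_nonneg _).trans_lt hlt
      nlinarith
    exact this.continuous
  · have h := key x x hx
    rw [real_inner_self_eq_norm_sq] at h
    have : ‖x - R x‖ = 0 := by nlinarith [norm_nonneg (x - R x)]
    exact (sub_eq_zero.1 (norm_eq_zero.1 this)).symm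

theorem Convex.exists_continuous_retraction_pi {ι : Type*} [Fintype ι] {K : Set (ι → ℝ)}
    (hne : K.Nonempty) (hcl : IsClosed K) (hconv : Convex ℝ K) :
    ∃ R : (ι → ℝ) → (ι → ℝ), Continuous R ∧ (∀ x, R x ∈ K) ∧ ∀ x ∈ K, R x = x := by
  let e := EuclideanSpace.equiv ι ℝ
  obtain ⟨R, hR, hRK, hRid⟩ := Convex.exists_continuous_retraction (K := e ⁻¹' K)
    (hne.preimage e.surjective) (hcl.preimage e.continuous)
    (hconv.linear_preimage e.toLinearMap)
  refine ⟨fun x => e (R (e.symm x)), by fun_prop, fun x => hRK _, fun x hx => ?_⟩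
  simp [hRid (e.symm x) (by simpa using hx)]

/-- Relative lifting for a convex compact set `K` and a retract `K'` of it, phrased in terms of
families of exit paths. -/
theorem IsSerreFibration.extend_exitPaths {P X : Type*} [TopologicalSpace X] {s : X → P} {p q : P}
    (hπ : IsSerreFibration (pairHolinkEv0 s p q)) {d : ℕ} {K K' : Set (Fin d → ℝ)}
    (hKc : IsCompact K) (hK : Convex ℝ K) {ρ : (Fin d → ℝ) → (Fin d → ℝ)}
    (hρ : ContinuousOn ρ K) (hρK : MapsTo ρ K K') (hK' : K' ⊆ K) (hρid : ∀ x ∈ K', ρ x = x)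
    {b : (Fin d → ℝ) → X} (hb : ContinuousOn b K) (hbp : ∀ x ∈ K, s (b x) = p)
    {e : (Fin d → ℝ) × ℝ → X} (he : ContinuousOn e (K' ×ˢ Icc 0 1))
    (he0 : ∀ x ∈ K', e (x, 0) = b x) (heq : ∀ x ∈ K', ∀ v ∈ Ioc (0 : ℝ) 1, s (e (x, v)) = q) :
    ∃ g : (Fin d → ℝ) × ℝ → X, ContinuousOn g (K ×ˢ Icc 0 1) ∧
      (∀ x ∈ K, g (x, 0) = b x) ∧ (∀ x ∈ K, ∀ v ∈ Ioc (0 : ℝ) 1, s (g (x, v)) = q) ∧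
      ∀ x ∈ K', ∀ v ∈ Icc (0 : ℝ) 1, g (x, v) = e (x, v) := by
  rcases K.eq_empty_or_nonempty with rfl | hne
  · have : K' = ∅ := subset_empty_iff.1 hK'
    subst this
    exact ⟨e, he, by simp, by simp, by simp⟩
  obtain ⟨R, hR, hRK, hRid⟩ := hK.exists_continuous_retraction_pi hne hKc.isClosed
  let E := EuclideanSpace.equiv (Fin d) ℝ
  obtain ⟨M, hM0, hM⟩ : ∃ M : ℝ, 0 < M ∧ ∀ x ∈ K, ‖E.symm x‖ ≤ M := by
    obtain ⟨M, hM⟩ := (hKc.image E.symm.continuous).isBounded.exists_norm_le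
    exact ⟨max M 1, by positivity, fun x hx =>
      (hM _ (mem_image_of_mem _ hx)).trans (le_max_left _ _)⟩
  obtain ⟨B, hB0, hB⟩ : ∃ B : ℝ, 0 < B ∧ ∀ x ∈ K, ‖x‖ ≤ B := by
    obtain ⟨M, hM⟩ := hKc.isBounded.exists_norm_le
    exact ⟨max M 1, by positivity, fun x hx => (hM _ hx).trans (le_max_left _ _)⟩
  let D := ↥(Metric.closedBall (0 : EuclideanSpace ℝ (Fin d)) 1)
  let ι : D → (Fin d → ℝ) := fun z => R (E (M • z.1))
  have hι : Continuous ι := by fun_prop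
  have hιK : ∀ z, ι z ∈ K := fun z => hRK _
  -- The straight line from `ρ c` to `c`, stopped coordinatewise.
  let r : (Fin d → ℝ) × ℝ → (Fin d → ℝ) := fun z =>
    R (fun i => ρ z.1 i + max (-(2 * B * z.2)) (min (2 * B * z.2) (z.1 i - ρ z.1 i)))
  have hr : ContinuousOn r (K ×ˢ univ) := by
    refine hR.comp_continuousOn (continuousOn_pi.2 fun i => ?_)
    have h1 : ContinuousOn (fun z : (Fin d → ℝ) × ℝ => ρ z.1 i) (K ×ˢ univ) :=
      (continuousOn_pi.1 hρ i).comp continuousOn_fst fun z hz => hz.1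
    have h2 : ContinuousOn (fun z : (Fin d → ℝ) × ℝ => z.1 i) (K ×ˢ univ) := by fun_prop
    have h3 : ContinuousOn (fun z : (Fin d → ℝ) × ℝ => 2 * B * z.2) (K ×ˢ univ) := by fun_prop
    exact h1.add (h3.neg.sup (h3.inf (h2.sub h1)))
  have hrK : ∀ z, r z ∈ K := fun z => hRK _
  have hr0 : ∀ c ∈ K, r (c, 0) = ρ c := by
    intro c hc
    have : r (c, 0) = R (ρ c) := by
      simp only [r]
      congr 1
      ext i
      rcases le_total 0 (c i - ρ c i) with h | h <;> simp [h]
    rw [this, hRid _ (hK' (hρK hc))]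
  have hr1 : ∀ c ∈ K, r (c, ‖c - ρ c‖ / (2 * B)) = c := by
    intro c hc
    have : r (c, ‖c - ρ c‖ / (2 * B)) = R c := by
      simp only [r]
      congr 1
      ext i
      have h1 : 2 * B * (‖c - ρ c‖ / (2 * B)) = ‖c - ρ c‖ := by field_simp
      have h2 : |c i - ρ c i| ≤ ‖c - ρ c‖ := norm_le_pi_norm (c - ρ c) i
      rw [h1, min_eq_right (abs_le.1 h2).2, max_eq_right (abs_le.1 h2).1]
      ring
    rw [this, hRid _ hc]
  let H : D × I → {x : X // s x = p} := fun z => ⟨b (r (ι z.1, z.2)), hbp _ (hrK _)⟩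
  have hH : Continuous H := by
    refine Continuous.subtype_mk ?_ _
    refine hb.comp_continuous ?_ fun z => hrK _
    exact hr.comp_continuous (by fun_prop) fun z => ⟨hιK _, trivial⟩
  have hce : Continuous fun z : D × I => e (ρ (ι z.1), (z.2 : ℝ)) := by
    refine he.comp_continuous ?_ fun z => ⟨hρK (hιK _), z.2.2⟩
    exact ((hρ.comp_continuous hι hιK).comp continuous_fst).prodMk (by fun_prop)
  let h₀ : D → PairHolink s p q := fun z =>
    ⟨ContinuousMap.curry ⟨_, hce⟩ z, by
      show s (e (ρ (ι z), ((0 : I) : ℝ))) = p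
      rw [Icc.coe_zero, he0 _ (hρK (hιK _)), hbp _ (hK' (hρK (hιK _)))],
      fun t ht => heq _ (hρK (hιK _)) _ ⟨unitInterval.pos_iff_ne_zero.2 ht, t.2.2⟩⟩
  have hh₀ : Continuous h₀ := Continuous.subtype_mk (ContinuousMap.curry ⟨_, hce⟩).continuous _
  obtain ⟨G, hG, hG0, hGH⟩ := hπ d H h₀ hH hh₀ fun z => by
    refine Subtype.ext ?_
    show e (ρ (ι z), ((0 : I) : ℝ)) = b (r (ι z, ((0 : I) : ℝ)))
    rw [Icc.coe_zero, he0 _ (hρK (hιK _)), hr0 _ (hιK _)]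
  have hmemD : ∀ c ∈ K, M⁻¹ • E.symm c ∈ Metric.closedBall (0 : EuclideanSpace ℝ (Fin d)) 1 := by
    intro c hc
    rw [mem_closedBall_zero_iff, norm_smul, norm_inv, Real.norm_of_nonneg hM0.le,
      inv_mul_le_iff₀ hM0, mul_one]
    exact hM c hc
  have hmemI : ∀ c ∈ K, ‖c - ρ c‖ / (2 * B) ∈ Icc (0 : ℝ) 1 := by
    intro c hc
    refine ⟨by positivity, (div_le_one (by positivity)).2 ?_⟩
    linarith [norm_sub_le c (ρ c), hB c hc, hB _ (hK' (hρK hc))]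
  let lift : K → D × I := fun c => (⟨_, hmemD c c.2⟩, ⟨_, hmemI c c.2⟩)
  have hlift : Continuous lift := by
    have h1 : Continuous fun c : K => ρ c := continuousOn_iff_continuous_domRestrict.1 hρ
    refine (Continuous.subtype_mk (by fun_prop) _).prodMk (Continuous.subtype_mk ?_ _)
    exact ((continuous_subtype_val.sub h1).norm).div_const _
  have hιlift : ∀ c : K, ι (lift c).1 = c := by
    intro c
    simp only [ι, lift]
    rw [smul_smul, mul_inv_cancel₀ hM0.ne', one_smul, E.apply_symm_apply, hRid _ c.2]
  let g' : K × I → X := fun z => (G (lift z.1)).1 z.2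
  have hg' : Continuous g' := by
    have h1 : Continuous fun c : K => (G (lift c)).1 :=
      continuous_subtype_val.comp (hG.comp hlift)
    exact ContinuousMap.continuous_uncurry_of_continuous ⟨_, h1⟩
  have hg'b : ∀ c : K, g' (c, 0) = b c := by
    intro c
    have := congrArg Subtype.val (hGH (lift c))
    simp only [pairHolinkEv0, H] at this
    simp only [g']
    rw [this, hιlift]
    exact congrArg b (hr1 c c.2)
  classical
  obtain ⟨c₀, hc₀⟩ := hne
  refine ⟨fun z => g' (if h : z.1 ∈ K then ⟨z.1, h⟩ else ⟨c₀, hc₀⟩, projIcc 0 1 zero_le_one z.2),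
    ?_, ?_, ?_, ?_⟩
  · rw [continuousOn_iff_continuous_domRestrict]
    refine Continuous.congr (f := fun z : (K ×ˢ Icc (0 : ℝ) 1 : Set ((Fin d → ℝ) × ℝ)) =>
      g' (⟨z.1.1, z.2.1⟩, projIcc 0 1 zero_le_one z.1.2)) ?_ fun z => ?_
    · exact hg'.comp ((Continuous.subtype_mk (by fun_prop) _).prodMk
        (continuous_projIcc.comp (by fun_prop)))
    · simp [domRestrict_apply, z.2.1]
  · intro x hx
    simp only [hx, dif_pos, projIcc_left]
    exact hg'b ⟨x, hx⟩
  · intro x hx v hv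
    simp only [hx, dif_pos]
    refine (G _).2.2 _ ?_
    rw [projIcc_of_mem zero_le_one (Ioc_subset_Icc_self hv)]
    exact fun h => hv.1.ne' (congrArg Subtype.val h)
  · intro x hx v hv
    have hxK := hK' hx
    simp only [hxK, dif_pos, projIcc_of_mem zero_le_one hv, g']
    have h1 : lift ⟨x, hxK⟩ = ((lift ⟨x, hxK⟩).1, 0) := by
      refine Prod.ext rfl (Subtype.ext ?_)
      simp [lift, hρid x hx]
    rw [h1, hG0]
    show e (ρ (ι (lift ⟨x, hxK⟩).1), v) = e (x, v)
    rw [hιlift, hρid x hx]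

lemma maxSupp_pos {n : ℕ} (x : stdSimplex ℝ (Fin (n + 1))) : 0 < x.1 (maxSupp x) :=
  (Finset.mem_filter.1 (Finset.max'_mem (Finset.univ.filter fun i => 0 < x.1 i) _)).2

lemma le_maxSupp {n : ℕ} {x : stdSimplex ℝ (Fin (n + 1))} {i : Fin (n + 1)} (hi : 0 < x.1 i) :
    i ≤ maxSupp x :=
  Finset.le_max' _ _ (Finset.mem_filter.2 ⟨Finset.mem_univ i, hi⟩)

lemma maxSupp_eq {n : ℕ} {x : stdSimplex ℝ (Fin (n + 1))} {j : Fin (n + 1)} (hj : 0 < x.1 j)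
    (h : ∀ i, j < i → x.1 i = 0) : maxSupp x = j :=
  le_antisymm (not_lt.1 fun hlt => (maxSupp_pos x).ne' (h _ hlt)) (le_maxSupp hj)

section Permutation

variable {P : Type*} [PartialOrder P] {n : ℕ} {J : Fin (n + 1) → P} (e : Equiv.Perm (Fin (n + 1)))

/-- Permutation of the barycentric coordinates. -/
def stdSimplex.perm (x : stdSimplex ℝ (Fin (n + 1))) : stdSimplex ℝ (Fin (n + 1)) :=
  ⟨x.1 ∘ e, fun i => x.2.1 (e i), (Equiv.sum_comp e x.1).trans x.2.2⟩

lemma stdSimplex.continuous_perm : Continuous (stdSimplex.perm e) := by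
  refine Continuous.subtype_mk (continuous_pi fun i => ?_) _
  exact (continuous_apply (e i)).comp continuous_subtype_val

lemma flagStrat_perm (hJ : Monotone J) (he : ∀ i, J (e i) = J i)
    (x : stdSimplex ℝ (Fin (n + 1))) : flagStrat J (stdSimplex.perm e x) = flagStrat J x := by
  refine le_antisymm ?_ ?_
  · rw [flagStrat, ← he]
    exact hJ (le_maxSupp (maxSupp_pos (stdSimplex.perm e x)))
  · rw [flagStrat, ← e.apply_symm_apply (maxSupp x), he]
    refine hJ (le_maxSupp ?_)
    simpa [stdSimplex.perm] using maxSupp_pos x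

variable {e}

lemma HornFilling.of_perm {X : Type*} [TopologicalSpace X] {s : X → P} (hJ : Monotone J)
    (he : ∀ i, J (e i) = J i) {k : Fin (n + 1)} (h : HornFilling s J (e k)) :
    HornFilling s J k := by
  intro f hf hfs
  have hmem : ∀ y : hornSet n (e k), stdSimplex.perm e y.1 ∈ hornSet n k := by
    rintro ⟨y, i, hi, hy⟩
    exact ⟨e.symm i, fun h => hi (by simp [← h]), (congrArg y.1 (e.apply_symm_apply i)).trans hy⟩
  obtain ⟨g, hg, hgs, hgf⟩ := h (fun y => f ⟨_, hmem y⟩)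
    (hf.comp (Continuous.subtype_mk ((stdSimplex.continuous_perm e).comp continuous_subtype_val) _))
    fun y => (hfs _).trans (flagStrat_perm e hJ he _)
  refine ⟨fun x => g (stdSimplex.perm e.symm x), hg.comp (stdSimplex.continuous_perm _),
    fun x => (hgs _).trans (flagStrat_perm _ hJ (fun i => ?_) _), ?_⟩
  · rw [← he, e.apply_symm_apply]
  · rintro ⟨x, i, hi, hx⟩
    refine (hgf ⟨stdSimplex.perm e.symm x, e i, e.injective.ne hi,
      (congrArg x.1 (e.symm_apply_apply i)).trans hx⟩).trans
        (congrArg f (Subtype.ext (Subtype.ext ?_)))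
    ext j
    simp [stdSimplex.perm]

end Permutation

lemma HornFilling.of_one {P X : Type*} [TopologicalSpace X] (s : X → P) {J : Fin 2 → P}
    (hJ : J 0 = J 1) (k : Fin 2) : HornFilling s J k := by
  have hJ' : ∀ i j, J i = J j := by
    intro i j
    fin_cases i <;> fin_cases j <;> simp [hJ]
  intro f _ hfs
  have hv1 : (Pi.single k 1 : Fin 2 → ℝ) ∈ stdSimplex ℝ (Fin 2) := single_mem_stdSimplex ℝ k
  let v : stdSimplex ℝ (Fin 2) := ⟨Pi.single k 1, hv1⟩
  have hv : v ∈ hornSet 1 k := ⟨k + 1, by simp, by simp [v]⟩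
  have hsingle : ∀ z : Fin 2 → ℝ, ∀ i, i ≠ k → z i = 0 → z 0 + z 1 = 1 → Pi.single k 1 = z := by
    intro z i hi hz hs
    ext j
    fin_cases i <;> fin_cases j <;> fin_cases k <;> simp_all
  refine ⟨fun _ => f ⟨v, hv⟩, continuous_const, fun x => (hfs _).trans (hJ' _ _), ?_⟩
  rintro ⟨y, i, hi, hy⟩
  exact congrArg f (Subtype.ext (Subtype.ext
    (hsingle y.1 i hi hy ((Fin.sum_univ_two _).symm.trans y.2.2))))

theorem CatFibrant.diagFibrant {P X : Type*} [PartialOrder P] [TopologicalSpace X] {s : X → P}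
    (h : CatFibrant s) : DiagFibrant s := by
  rintro n J hJ k (hk | ⟨hk, hn, h01⟩ | ⟨hk, hn, h01⟩)
  · exact h n J hJ k hk
  · obtain rfl | hn1 := (Nat.succ_le_of_lt hn).eq_or_lt
    · exact HornFilling.of_one s h01 k
    obtain rfl : k = ⟨0, Nat.succ_pos n⟩ := Fin.ext hk
    refine HornFilling.of_perm hJ (Equiv.apply_swap_eq_self h01) ?_
    rw [Equiv.swap_apply_left]
    exact h n J hJ _ ⟨Nat.one_pos, hn1⟩
  · obtain rfl | hn1 := (Nat.succ_le_of_lt hn).eq_or_lt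
    · exact HornFilling.of_one s h01 k
    obtain rfl : k = ⟨n, Nat.lt_succ_self n⟩ := Fin.ext hk
    refine HornFilling.of_perm hJ (Equiv.apply_swap_eq_self h01) ?_
    rw [Equiv.swap_apply_right]
    exact h n J hJ _ ⟨Nat.sub_pos_of_lt hn1, Nat.sub_lt hn Nat.one_pos⟩

lemma flagStrat_ite_of_pos {P : Type*} {m : ℕ} (p q : P) {x : stdSimplex ℝ (Fin (m + 3))}
    (hx : 0 < x.1 (Fin.last (m + 2))) :
    flagStrat (fun i : Fin (m + 3) => if (i : ℕ) ≤ m + 1 then p else q) x = q := by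
  rw [flagStrat, maxSupp_eq hx fun i hi => absurd hi (Fin.le_last i).not_gt]
  simp

lemma flagStrat_ite_of_eq_zero {P : Type*} {m : ℕ} (p q : P) {x : stdSimplex ℝ (Fin (m + 3))}
    (hx : x.1 (Fin.last (m + 2)) = 0) :
    flagStrat (fun i : Fin (m + 3) => if (i : ℕ) ≤ m + 1 then p else q) x = p := by
  have h1 : maxSupp x ≠ Fin.last (m + 2) := fun h => (maxSupp_pos x).ne' (h ▸ hx)
  have h2 : (maxSupp x : ℕ) ≤ m + 1 := by
    have := (maxSupp x).2
    have : (maxSupp x : ℕ) ≠ m + 2 := fun h => h1 (Fin.ext h)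
    omega
  simp [flagStrat, h2]

/-- The smallest coordinate. -/
def minCoord {m : ℕ} (a : Fin (m + 1) → ℝ) : ℝ := Finset.univ.inf' Finset.univ_nonempty a

lemma minCoord_le {m : ℕ} (a : Fin (m + 1) → ℝ) (j : Fin (m + 1)) : minCoord a ≤ a j :=
  Finset.inf'_le _ (Finset.mem_univ j)

lemma exists_eq_minCoord {m : ℕ} (a : Fin (m + 1) → ℝ) : ∃ j, minCoord a = a j := by
  obtain ⟨j, -, hj⟩ := Finset.exists_mem_eq_inf' Finset.univ_nonempty a
  exact ⟨j, hj⟩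

lemma minCoord_eq {m : ℕ} {a : Fin (m + 1) → ℝ} {j : Fin (m + 1)} (h : ∀ i, a j ≤ a i) :
    minCoord a = a j :=
  le_antisymm (minCoord_le a j) (Finset.le_inf' _ _ fun i _ => h i)

lemma continuous_minCoord {m : ℕ} : Continuous (minCoord : (Fin (m + 1) → ℝ) → ℝ) :=
  Continuous.finset_inf'_apply _ fun i _ => continuous_apply i

/-- The local collar of the vertex `m + 1` in the simplex, parametrized by a disk, a homotopy
parameter and a path parameter. -/
theorem exists_disk_embedding (m : ℕ) :
    ∃ (i : ↥(Metric.closedBall (0 : EuclideanSpace ℝ (Fin m)) 1) × I × I →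
        stdSimplex ℝ (Fin (m + 3)))
      (r : stdSimplex ℝ (Fin (m + 3)) → ↥(Metric.closedBall (0 : EuclideanSpace ℝ (Fin m)) 1))
      (a b : stdSimplex ℝ (Fin (m + 3)) → I),
      Continuous i ∧ Continuous r ∧ Continuous a ∧ Continuous b ∧
      (∀ z, r (i z) = z.1) ∧ (∀ z, a (i z) = z.2.1) ∧ (∀ z, b (i z) = z.2.2) ∧
      (∀ x, b x = 0 ↔ x.1 (Fin.last (m + 2)) = 0) ∧
      ∀ x, x ∈ hornSet (m + 2) ⟨m + 1, by omega⟩ ↔ a x = 0 ∨ b x = 0 := by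
  let D := ↥(Metric.closedBall (0 : EuclideanSpace ℝ (Fin m)) 1)
  let c : ℝ := 1 / (3 * m + 10)
  have hc : 0 < c := by positivity
  have hc' : c * (3 * m + 10) = 1 := by simp only [c]; field_simp
  let dt : D → Fin (m + 1) → ℝ := fun d => Fin.snoc (α := fun _ => ℝ) d.1.ofLp 0
  have hdt : Continuous dt := by
    refine continuous_pi fun j => ?_
    refine Fin.lastCases ?_ (fun j => ?_) j
    · simpa [dt] using continuous_const
    · simp only [dt, Fin.snoc_castSucc]
      exact (continuous_apply j).comp ((PiLp.continuous_ofLp 2 _).comp continuous_subtype_val)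
  have hdt1 : ∀ d j, |dt d j| ≤ 1 := by
    intro d j
    refine Fin.lastCases ?_ (fun j => ?_) j
    · simp [dt]
    · simp only [dt, Fin.snoc_castSucc]
      exact (PiLp.norm_apply_le d.1 j).trans (mem_closedBall_zero_iff.1 d.2)
  let A : D × I × I → Fin (m + 1) → ℝ := fun z j =>
    c * (dt z.1 j - minCoord (dt z.1)) + c * z.2.1
  have hA : Continuous A := by
    refine continuous_pi fun j => ?_
    have h1 := (continuous_apply j).comp (hdt.comp (continuous_fst (X := D) (Y := I × I)))
    have h2 := continuous_minCoord.comp (hdt.comp (continuous_fst (X := D) (Y := I × I)))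
    exact ((h1.sub h2).const_mul c).add (by fun_prop)
  have hA0 : ∀ z j, 0 ≤ A z j := fun z j =>
    add_nonneg (mul_nonneg hc.le (sub_nonneg.2 (minCoord_le _ _))) (mul_nonneg hc.le z.2.1.2.1)
  have hA3 : ∀ z j, A z j ≤ c * 3 := by
    intro z j
    obtain ⟨l, hl⟩ := exists_eq_minCoord (dt z.1)
    have h1 := abs_le.1 (hdt1 z.1 j)
    have h2 := abs_le.1 (hdt1 z.1 l)
    have h3 := z.2.1.2.2
    simp only [A, ← mul_add]
    exact mul_le_mul_of_nonneg_left (by linarith) hc.le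
  have hAmin : ∀ z, minCoord (A z) = c * z.2.1 := by
    intro z
    obtain ⟨l, hl⟩ := exists_eq_minCoord (dt z.1)
    have : A z l = c * z.2.1 := by simp [A, hl]
    rw [← this]
    refine minCoord_eq fun j => ?_
    rw [this]
    exact le_add_of_nonneg_left (mul_nonneg hc.le (sub_nonneg.2 (minCoord_le _ _)))
  have hsum : ∀ z, ∑ j, A z j + c * z.2.2 ≤ 1 := by
    intro z
    have h1 : ∑ j, A z j ≤ (m + 1) * (c * 3) := by
      refine (Finset.sum_le_sum fun j _ => hA3 z j).trans ?_
      simp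
    have h2 := mul_le_mul_of_nonneg_left z.2.2.2.2 hc.le
    nlinarith
  let i : D × I × I → stdSimplex ℝ (Fin (m + 3)) := fun z =>
    ⟨Fin.snoc (α := fun _ => ℝ) (Fin.snoc (α := fun _ => ℝ) (A z) (1 - ∑ j, A z j - c * z.2.2))
      (c * z.2.2), by
      refine ⟨fun l => ?_, ?_⟩
      · refine Fin.lastCases ?_ (fun l => ?_) l
        · simpa using mul_nonneg hc.le z.2.2.2.1
        refine Fin.lastCases ?_ (fun l => ?_) l
        · simp only [Fin.snoc_castSucc, Fin.snoc_last]
          linarith [hsum z]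
        · simpa using hA0 z l
      · rw [Fin.sum_univ_castSucc, Fin.sum_univ_castSucc]
        simp only [Fin.snoc_castSucc, Fin.snoc_last]
        ring⟩
  have hiA : ∀ z j, (i z).1 j.castSucc.castSucc = A z j := fun z j => by
    simp [i]
  have hilast : ∀ z, (i z).1 (Fin.last (m + 2)) = c * z.2.2 := fun z => by
    simp [i]
  have hi : Continuous i := by
    refine Continuous.subtype_mk (continuous_pi fun l => ?_) _
    refine Fin.lastCases ?_ (fun l => ?_) l
    · simp only [Fin.snoc_last]
      fun_prop
    refine Fin.lastCases ?_ (fun l => ?_) l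
    · simp only [Fin.snoc_castSucc, Fin.snoc_last]
      fun_prop
    · simp only [Fin.snoc_castSucc]
      fun_prop
  let v : stdSimplex ℝ (Fin (m + 3)) → EuclideanSpace ℝ (Fin m) := fun x =>
    WithLp.toLp 2 fun j =>
      (x.1 j.castSucc.castSucc.castSucc - x.1 (Fin.last m).castSucc.castSucc) / c
  have hx : ∀ l, Continuous fun x : stdSimplex ℝ (Fin (m + 3)) => x.1 l := fun l =>
    (continuous_apply l).comp continuous_subtype_val
  have hv : Continuous v :=
    (PiLp.continuous_toLp 2 _).comp (continuous_pi fun j => ((hx _).sub (hx _)).div_const c)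
  let mn : stdSimplex ℝ (Fin (m + 3)) → ℝ := fun x =>
    minCoord fun j : Fin (m + 1) => x.1 j.castSucc.castSucc
  have hmn : Continuous mn := continuous_minCoord.comp (continuous_pi fun j => hx _)
  have hmn0 : ∀ x, 0 ≤ mn x := fun x => by
    obtain ⟨j, hj⟩ := exists_eq_minCoord fun j : Fin (m + 1) => x.1 j.castSucc.castSucc
    exact (x.2.1 j.castSucc.castSucc).trans_eq hj.symm
  have hproj : ∀ y : ℝ, 0 ≤ y → (projIcc (0 : ℝ) 1 zero_le_one (y / c) = 0 ↔ y = 0) := by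
    intro y hy
    rw [show (0 : I) = ⟨0, left_mem_Icc.2 zero_le_one⟩ from rfl, projIcc_eq_left zero_lt_one,
      div_le_iff₀ hc, zero_mul]
    exact ⟨fun h => le_antisymm h hy, fun h => h.le⟩
  have hproj' : ∀ t : I, projIcc (0 : ℝ) 1 zero_le_one (c * t / c) = t := fun t => by
    rw [mul_div_cancel_left₀ _ hc.ne', projIcc_val]
  refine ⟨i, fun x => ⟨(max 1 ‖v x‖)⁻¹ • v x, ?_⟩, fun x => projIcc 0 1 zero_le_one (mn x / c),
    fun x => projIcc 0 1 zero_le_one (x.1 (Fin.last (m + 2)) / c), hi, ?_, ?_, ?_, ?_, ?_, ?_, ?_,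
    ?_⟩
  · rw [mem_closedBall_zero_iff, norm_smul, norm_inv, Real.norm_of_nonneg (by positivity),
      inv_mul_le_iff₀ (by positivity), mul_one]
    exact le_max_right _ _
  · refine Continuous.subtype_mk (((continuous_const.max hv.norm).inv₀ fun x => ?_).smul hv) _
    positivity
  · exact continuous_projIcc.comp (hmn.div_const c)
  · exact continuous_projIcc.comp ((hx _).div_const c)
  · intro z
    have hvz : v (i z) = z.1.1 := by
      ext j
      show ((i z).1 j.castSucc.castSucc.castSucc - (i z).1 (Fin.last m).castSucc.castSucc) / c = _
      rw [hiA, hiA]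
      simp only [A, dt, Fin.snoc_castSucc, Fin.snoc_last]
      field_simp
      ring
    refine Subtype.ext ?_
    simp only [hvz]
    rw [max_eq_left (mem_closedBall_zero_iff.1 z.1.2), inv_one, one_smul]
  · intro z
    have : mn (i z) = c * z.2.1 := by
      rw [← hAmin]
      exact congrArg minCoord (funext (hiA z))
    simp only [this, hproj']
  · intro z
    simp only [hilast, hproj']
  · exact fun x => hproj _ (x.2.1 _)
  · intro x
    rw [hproj _ (hmn0 x), hproj _ (x.2.1 _)]
    constructor
    · rintro ⟨l, hl, hl0⟩
      revert hl hl0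
      refine Fin.lastCases (fun _ h => Or.inr h) (fun l => ?_) l
      refine Fin.lastCases (fun h => (h rfl).elim) (fun l => ?_) l
      intro _ h
      exact Or.inl (le_antisymm ((minCoord_le _ l).trans_eq h) (hmn0 x))
    · rintro (h | h)
      · obtain ⟨j, hj⟩ := exists_eq_minCoord fun j : Fin (m + 1) => x.1 j.castSucc.castSucc
        exact ⟨j.castSucc.castSucc, fun h => absurd (congrArg Fin.val h) j.2.ne, hj.symm.trans h⟩
      · exact ⟨_, fun h => by simpa using congrArg Fin.val h, h⟩

theorem isSerreFibration_of_hornFilling {P X : Type*} [TopologicalSpace X] {s : X → P} {p q : P}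
    (h : ∀ m : ℕ, HornFilling s (fun i : Fin (m + 3) => if (i : ℕ) ≤ m + 1 then p else q)
      ⟨m + 1, by omega⟩) : IsSerreFibration (pairHolinkEv0 s p q) := by
  intro m H h₀ hH hh₀ hHh
  obtain ⟨i, r, a, b, hi, hr, ha, hb, hri, hai, hbi, hb0, hhorn⟩ := exists_disk_embedding m
  have hH' : ∀ d, (H (d, 0)).1 = (h₀ d).1 0 := fun d => congrArg Subtype.val (hHh d).symm
  let f : stdSimplex ℝ (Fin (m + 3)) → X := fun x =>
    if b x ≤ a x then (H (r x, a x)).1 else (h₀ (r x)).1 (b x)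
  have hev : Continuous fun z : ↥(Metric.closedBall (0 : EuclideanSpace ℝ (Fin m)) 1) × I =>
      (h₀ z.1).1 z.2 :=
    ContinuousMap.continuous_uncurry_of_continuous ⟨_, continuous_subtype_val.comp hh₀⟩
  have hf : Continuous fun y : hornSet (m + 2) ⟨m + 1, by omega⟩ => f y.1 := by
    refine Continuous.if_le ?_ ?_ (hb.comp continuous_subtype_val)
      (ha.comp continuous_subtype_val) fun y hy => ?_
    · exact (continuous_subtype_val.comp hH).comp ((hr.prodMk ha).comp continuous_subtype_val)
    · exact hev.comp ((hr.prodMk hb).comp continuous_subtype_val)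
    · have : a y.1 = 0 ∧ b y.1 = 0 := by
        rcases (hhorn y.1).1 y.2 with h | h
        · exact ⟨h, hy.trans h⟩
        · exact ⟨hy.symm.trans h, h⟩
      rw [this.1, this.2, hH']
  obtain ⟨g, hg, hgs, hgf⟩ := h m (fun y => f y.1) hf fun y => by
    by_cases hab : b y.1 ≤ a y.1
    · have hby : b y.1 = 0 := by
        rcases (hhorn y.1).1 y.2 with h | h
        · exact le_antisymm (hab.trans_eq h) bot_le
        · exact h
      rw [flagStrat_ite_of_eq_zero p q ((hb0 _).1 hby)]
      simp only [f, hab, if_true]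
      exact (H _).2
    · have hby : b y.1 ≠ 0 := fun h => hab (h.trans_le bot_le)
      rw [flagStrat_ite_of_pos p q
        (lt_of_le_of_ne (y.1.2.1 _) fun h => hby ((hb0 _).2 h.symm))]
      simp only [f, hab, if_false]
      exact (h₀ _).2.2 _ hby
  have hgi : Continuous fun z : (↥(Metric.closedBall (0 : EuclideanSpace ℝ (Fin m)) 1) × I) × I =>
      g (i (z.1.1, z.1.2, z.2)) := by fun_prop
  refine ⟨fun w => ⟨ContinuousMap.curry ⟨_, hgi⟩ w, ?_, fun t ht => ?_⟩,
    Continuous.subtype_mk (ContinuousMap.curry ⟨_, hgi⟩).continuous _, fun d => ?_, fun z => ?_⟩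
  · show s (g (i (w.1, w.2, 0))) = p
    rw [hgs, flagStrat_ite_of_eq_zero p q ((hb0 _).1 (hbi _))]
  · show s (g (i (w.1, w.2, t))) = q
    have : b (i (w.1, w.2, t)) ≠ 0 := by rwa [hbi]
    rw [hgs, flagStrat_ite_of_pos p q
      (lt_of_le_of_ne ((i _).2.1 _) fun h => this ((hb0 _).2 h.symm))]
  · refine Subtype.ext (ContinuousMap.ext fun u => ?_)
    show g (i (d, 0, u)) = (h₀ d).1 u
    rw [hgf ⟨i (d, 0, u), (hhorn _).2 (Or.inl (hai _))⟩]
    simp only [f, hai, hbi, hri]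
    split_ifs with hu
    · rw [hH', le_antisymm hu bot_le]
    · rfl
  · refine Subtype.ext ?_
    show g (i (z.1, z.2, 0)) = (H z).1
    rw [hgf ⟨i (z.1, z.2, 0), (hhorn _).2 (Or.inr (hbi _))⟩]
    simp only [f, hai, hbi, hri]
    exact if_pos bot_le

/-- A composite with a possibly discontinuous map `y` into a compact set is continuous provided
`Ψ (a, ·)` is constant wherever `y` is discontinuous. -/
theorem ContinuousOn.of_continuousWithinAt_or_const {α β X : Type*} [TopologicalSpace α]
    [TopologicalSpace β] [TopologicalSpace X] {A : Set α} {K : Set β} {Ψ : α × β → X} {y : α → β}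
    (hΨ : ContinuousOn Ψ (A ×ˢ K)) (hK : IsCompact K) (hy : MapsTo y A K)
    (h : ∀ a ∈ A, ContinuousWithinAt y A a ∨ ∀ b ∈ K, Ψ (a, b) = Ψ (a, y a)) :
    ContinuousOn (fun a => Ψ (a, y a)) A := by
  intro a ha
  rcases h a ha with hc | hc
  · have h1 : ContinuousWithinAt (fun x => (x, y x)) A a := continuousWithinAt_id.prodMk hc
    exact ContinuousWithinAt.comp (g := Ψ) (hΨ (a, y a) ⟨ha, hy ha⟩) h1 fun x hx => ⟨hx, hy hx⟩
  · intro U hU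
    have key : ∀ᶠ x in nhds a, ∀ b ∈ K, x ∈ A → b ∈ K → Ψ (x, b) ∈ U := by
      refine hK.eventually_forall_of_forall_eventually
        (P := fun x b => x ∈ A → b ∈ K → Ψ (x, b) ∈ U) fun b hb => ?_
      have h1 := hΨ (a, b) ⟨ha, hb⟩ (by rwa [hc b hb] : U ∈ nhds (Ψ (a, b)))
      filter_upwards [mem_nhdsWithin_iff_eventually.1 h1] with z hz hzA hzK
      exact hz ⟨hzA, hzK⟩
    refine Filter.mem_map.2 ?_
    filter_upwards [mem_nhdsWithin_of_mem_nhds key, self_mem_nhdsWithin] with x hx hxA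
    exact hx _ (hy hxA) hxA (hy hxA)

section ConeExtension

variable {n : ℕ} (m : Fin (n + 1))

/-- The sum of the coordinates before the `m`-th one. -/
def lowSum (z : Fin (n + 1) → ℝ) : ℝ := ∑ i ∈ Finset.Iio m, z i

/-- The sum of the coordinates after the `m`-th one. -/
def highSum (z : Fin (n + 1) → ℝ) : ℝ := ∑ i ∈ Finset.Ioi m, z i

lemma sum_eq_lowSum_add_highSum (z : Fin (n + 1) → ℝ) :
    ∑ i, z i = lowSum m z + z m + highSum m z := by
  have h1 : (Finset.univ : Finset (Fin (n + 1))) = Finset.Iic m ∪ Finset.Ioi m := by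
    ext i
    simp [le_or_gt]
  have h2 : Disjoint (Finset.Iic m) (Finset.Ioi m) := by
    rw [Finset.disjoint_left]
    intro i hi hi'
    exact (Finset.mem_Iic.1 hi).not_gt (Finset.mem_Ioi.1 hi')
  rw [h1, Finset.sum_union h2, ← Finset.Iio_insert, Finset.sum_insert (by simp), add_comm (z m)]
  rfl

lemma continuous_lowSum : Continuous (lowSum m) := by
  unfold lowSum
  fun_prop

lemma continuous_highSum : Continuous (highSum m) := by
  unfold highSum
  fun_prop

variable {m}

lemma highSum_nonneg {z : Fin (n + 1) → ℝ} (hz : ∀ i, 0 ≤ z i) : 0 ≤ highSum m z :=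
  Finset.sum_nonneg fun i _ => hz i

lemma le_highSum {z : Fin (n + 1) → ℝ} (hz : ∀ i, 0 ≤ z i) {i : Fin (n + 1)} (hi : m < i) :
    z i ≤ highSum m z :=
  Finset.single_le_sum (fun j _ => hz j) (Finset.mem_Ioi.2 hi)

lemma le_lowSum {z : Fin (n + 1) → ℝ} (hz : ∀ i, 0 ≤ z i) {i : Fin (n + 1)} (hi : i < m) :
    z i ≤ lowSum m z :=
  Finset.single_le_sum (fun j _ => hz j) (Finset.mem_Iio.2 hi)

lemma highSum_eq_zero_iff {z : Fin (n + 1) → ℝ} (hz : ∀ i, 0 ≤ z i) :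
    highSum m z = 0 ↔ ∀ i, m < i → z i = 0 := by
  rw [highSum, Finset.sum_eq_zero_iff_of_nonneg fun i _ => hz i]
  simp

lemma highSum_pos_iff {z : Fin (n + 1) → ℝ} (hz : ∀ i, 0 ≤ z i) :
    0 < highSum m z ↔ ∃ i, m < i ∧ 0 < z i := by
  rw [(highSum_nonneg hz).lt_iff_ne', Ne, highSum_eq_zero_iff hz]
  push Not
  exact exists_congr fun i => and_congr_right fun _ => ((hz i).lt_iff_ne').symm

variable (m)

/-- The link slice: nonnegative vectors with `m`-th coordinate `1` and whose later coordinates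
sum up to `1`. -/
def linkSlice : Set (Fin (n + 1) → ℝ) := {ζ | (∀ i, 0 ≤ ζ i) ∧ ζ m = 1 ∧ highSum m ζ = 1}

/-- The part of the link slice where the earlier coordinates sum up to at most `N`. -/
def truncSlice (N : ℕ) : Set (Fin (n + 1) → ℝ) := {ζ ∈ linkSlice m | lowSum m ζ ≤ N}

/-- The part of the link slice lying over the `k`-th horn. -/
def hornSlice (k : Fin (n + 1)) : Set (Fin (n + 1) → ℝ) := {ζ ∈ linkSlice m | ∃ i, i ≠ k ∧ ζ i = 0}

lemma isClosed_linkSlice : IsClosed (linkSlice m) := by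
  have h : linkSlice m = (⋂ i, {ζ | 0 ≤ ζ i}) ∩ ({ζ | ζ m = 1} ∩ {ζ | highSum m ζ = 1}) := by
    ext ζ
    simp [linkSlice]
  rw [h]
  exact (isClosed_iInter fun i => isClosed_le continuous_const (continuous_apply i)).inter
    ((isClosed_eq (continuous_apply m) continuous_const).inter
      (isClosed_eq (continuous_highSum m) continuous_const))

lemma isClosed_truncSlice (N : ℕ) : IsClosed (truncSlice m N) :=
  (isClosed_linkSlice m).inter (isClosed_le (continuous_lowSum m) continuous_const)

lemma isClosed_hornSlice (k : Fin (n + 1)) : IsClosed (hornSlice m k) := by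
  have h : hornSlice m k = linkSlice m ∩ ⋃ i, {ζ | i ≠ k ∧ ζ i = 0} := by
    ext ζ
    simp [hornSlice]
  rw [h]
  refine (isClosed_linkSlice m).inter (isClosed_iUnion_of_finite fun i => ?_)
  exact isClosed_const.inter (isClosed_eq (continuous_apply i) continuous_const)

lemma convex_truncSlice (N : ℕ) : Convex ℝ (truncSlice m N) := by
  rintro x ⟨⟨hx0, hxm, hxh⟩, hxl⟩ y ⟨⟨hy0, hym, hyh⟩, hyl⟩ a b ha hb hab
  have hsum : ∀ t : Finset (Fin (n + 1)),
      ∑ i ∈ t, (a • x + b • y) i = a * ∑ i ∈ t, x i + b * ∑ i ∈ t, y i := by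
    intro t
    simp [Finset.sum_add_distrib, Finset.mul_sum]
  refine ⟨⟨fun i => ?_, ?_, ?_⟩, ?_⟩
  · have := hx0 i
    have := hy0 i
    simp only [Pi.add_apply, Pi.smul_apply, smul_eq_mul]
    positivity
  · simp [hxm, hym, hab]
  · rw [highSum, hsum]
    change a * highSum m x + b * highSum m y = 1
    rw [hxh, hyh]
    linarith
  · rw [lowSum, hsum]
    change a * lowSum m x + b * lowSum m y ≤ N
    nlinarith

lemma isCompact_truncSlice (N : ℕ) : IsCompact (truncSlice m N) := by
  refine (isCompact_univ_pi (s := fun _ : Fin (n + 1) => Icc (0 : ℝ) (N + 1))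
    fun _ => isCompact_Icc).of_isClosed_subset (isClosed_truncSlice m N) ?_
  rintro ζ ⟨⟨h0, hm, hh⟩, hl⟩ i -
  have hN : (0 : ℝ) ≤ N := N.cast_nonneg
  refine ⟨h0 i, ?_⟩
  rcases lt_trichotomy i m with hi | rfl | hi
  · have : lowSum m ζ ≤ N := hl
    linarith [le_lowSum h0 hi]
  · linarith
  · linarith [le_highSum h0 hi]

lemma truncSlice_mono {N M : ℕ} (h : N ≤ M) : truncSlice m N ⊆ truncSlice m M :=
  fun _ hζ => ⟨hζ.1, le_trans hζ.2 (Nat.cast_le.2 h)⟩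

/-- The slice truncated at height `N + 1` retracts onto the union of the slice truncated at
height `N` with the part of it lying over the horn. -/
theorem exists_retraction_truncSlice {k : Fin (n + 1)} (hk : 0 < k) (hkm : k ≤ m) (N : ℕ) :
    ∃ ρ : (Fin (n + 1) → ℝ) → (Fin (n + 1) → ℝ), ContinuousOn ρ (truncSlice m (N + 1)) ∧
      MapsTo ρ (truncSlice m (N + 1))
        (truncSlice m N ∪ (hornSlice m k ∩ truncSlice m (N + 1))) ∧
      ∀ ζ ∈ truncSlice m N ∪ (hornSlice m k ∩ truncSlice m (N + 1)), ρ ζ = ζ := by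
  let δ : ℝ := 1 / (2 * (n + 1))
  have hδ : 0 < δ := by positivity
  let c : Fin (n + 1) → ℝ := fun i => if i = k ∨ i = m then 0 else if i < m then 1 else δ
  have hcpos : ∀ i, i ≠ k → i ≠ m → 0 < c i := by
    intro i h1 h2
    simp only [c, h1, h2, or_self, if_false]
    split_ifs <;> positivity
  have hc0 : ∀ i, 0 ≤ c i := by
    intro i
    simp only [c]
    split_ifs <;> positivity
  have hchigh : ∀ i, m < i → c i = δ := by
    intro i hi
    simp [c, hi.ne', (hkm.trans_lt hi).ne', hi.not_gt]
  have h0m : (0 : Fin (n + 1)) < m := hk.trans_le hkm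
  have hc00 : c 0 = 1 := by simp [c, hk.ne, h0m.ne, h0m]
  have hcm : c m = 0 := by simp [c]
  let t : Finset (Fin (n + 1)) := Finset.univ.filter fun i => i ≠ k ∧ i ≠ m
  have ht : t.Nonempty := ⟨0, by simp [t, hk.ne, h0m.ne]⟩
  let a : (Fin (n + 1) → ℝ) → ℝ := fun ζ => t.inf' ht fun i => ζ i / c i
  let σ' : (Fin (n + 1) → ℝ) → ℝ := fun ζ => min (a ζ) (max (lowSum m ζ - N) 0)
  have ha : Continuous a :=
    Continuous.finset_inf'_apply ht fun i _ => (continuous_apply i).div_const _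
  have hσ : Continuous σ' :=
    ha.min (((continuous_lowSum m).sub continuous_const).max continuous_const)
  let raw : (Fin (n + 1) → ℝ) → (Fin (n + 1) → ℝ) := fun ζ i => ζ i - σ' ζ * c i
  have hraw : Continuous raw := by fun_prop
  have ha0 : ∀ ζ ∈ linkSlice m, 0 ≤ a ζ := fun ζ hζ =>
    Finset.le_inf' _ _ fun i _ => div_nonneg (hζ.1 i) (hc0 i)
  have hσ0 : ∀ ζ ∈ linkSlice m, 0 ≤ σ' ζ := fun ζ hζ => le_min (ha0 ζ hζ) (le_max_right _ _)
  have hσ1 : ∀ ζ ∈ truncSlice m (N + 1), σ' ζ ≤ 1 := by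
    intro ζ hζ
    refine (min_le_right _ _).trans (max_le ?_ zero_le_one)
    have : lowSum m ζ ≤ (N + 1 : ℕ) := hζ.2
    push_cast at this
    linarith
  have hraw0 : ∀ ζ ∈ linkSlice m, ∀ i, 0 ≤ raw ζ i := by
    intro ζ hζ i
    by_cases hi : i ≠ k ∧ i ≠ m
    · have h1 : σ' ζ ≤ ζ i / c i :=
        (min_le_left _ _).trans (Finset.inf'_le _ (by simpa [t] using hi))
      have h2 := (le_div_iff₀ (hcpos i hi.1 hi.2)).1 h1
      simpa [raw] using h2
    · have : c i = 0 := by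
        have : i = k ∨ i = m := by tauto
        simp [c, this]
      simp [raw, this, hζ.1 i]
  have hhigh : ∀ ζ ∈ truncSlice m (N + 1), 0 < highSum m (raw ζ) := by
    intro ζ hζ
    have h1 : highSum m (raw ζ) = highSum m ζ - σ' ζ * ∑ i ∈ Finset.Ioi m, c i := by
      simp [highSum, raw, Finset.sum_sub_distrib, Finset.mul_sum]
    have h2 : ∑ i ∈ Finset.Ioi m, c i ≤ 1 / 2 := by
      rw [Finset.sum_congr rfl fun i hi => hchigh i (Finset.mem_Ioi.1 hi), Finset.sum_const,
        nsmul_eq_mul]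
      have h3 : ((Finset.Ioi m).card : ℝ) ≤ n + 1 := by
        have := Finset.card_le_univ (Finset.Ioi m)
        rw [Fintype.card_fin] at this
        exact_mod_cast this
      calc _ ≤ ((n : ℝ) + 1) * δ := mul_le_mul_of_nonneg_right h3 hδ.le
        _ = 1 / 2 := by simp only [δ]; field_simp
    have h3 := hσ0 ζ hζ.1
    have h4 := hσ1 ζ hζ
    have h5 : 0 ≤ ∑ i ∈ Finset.Ioi m, c i := Finset.sum_nonneg fun i _ => hc0 i
    rw [h1, hζ.1.2.2]
    nlinarith
  let ρ : (Fin (n + 1) → ℝ) → (Fin (n + 1) → ℝ) := fun ζ i =>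
    if m < i then raw ζ i / highSum m (raw ζ) else raw ζ i
  have hρlow : ∀ ζ, lowSum m (ρ ζ) = lowSum m (raw ζ) := fun ζ =>
    Finset.sum_congr rfl fun i hi => by simp [ρ, (Finset.mem_Iio.1 hi).not_gt]
  have hlowle : ∀ ζ ∈ linkSlice m, lowSum m (raw ζ) ≤ lowSum m ζ - σ' ζ := by
    intro ζ hζ
    have h1 : lowSum m (raw ζ) = lowSum m ζ - σ' ζ * lowSum m c := by
      simp [lowSum, raw, Finset.sum_sub_distrib, Finset.mul_sum]
    have h2 : 1 ≤ lowSum m c := hc00 ▸ le_lowSum hc0 h0m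
    nlinarith [hσ0 ζ hζ]
  have hρT : ∀ ζ ∈ truncSlice m (N + 1), ρ ζ ∈ truncSlice m (N + 1) := by
    intro ζ hζ
    refine ⟨⟨fun i => ?_, ?_, ?_⟩, ?_⟩
    · have := hraw0 ζ hζ.1 i
      have := hhigh ζ hζ
      simp only [ρ]
      split_ifs <;> positivity
    · simp [ρ, raw, hcm, hζ.1.2.1]
    · have : highSum m (ρ ζ) = highSum m (raw ζ) / highSum m (raw ζ) := by
        conv_rhs => rw [highSum, Finset.sum_div]
        exact Finset.sum_congr rfl fun i hi => if_pos (Finset.mem_Ioi.1 hi)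
      rw [this, div_self (hhigh ζ hζ).ne']
    · show lowSum m (ρ ζ) ≤ _
      rw [hρlow]
      linarith [hlowle ζ hζ.1, hσ0 ζ hζ.1, show lowSum m ζ ≤ (N + 1 : ℕ) from hζ.2]
  refine ⟨ρ, continuousOn_pi.2 fun i => ?_, fun ζ hζ => ?_, fun ζ hζ => ?_⟩
  · by_cases hi : m < i
    · simp only [ρ, hi, if_true]
      exact ((continuous_apply i).comp hraw).continuousOn.div
        ((continuous_highSum m).comp hraw).continuousOn fun ζ hζ => (hhigh ζ hζ).ne'
    · simp only [ρ, hi, if_false]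
      exact ((continuous_apply i).comp hraw).continuousOn
  · rcases le_total (a ζ) (max (lowSum m ζ - N) 0) with h | h
    · right
      refine ⟨⟨(hρT ζ hζ).1, ?_⟩, hρT ζ hζ⟩
      obtain ⟨i, hit, hi⟩ := Finset.exists_mem_eq_inf' ht fun i => ζ i / c i
      have hi' : i ≠ k ∧ i ≠ m := by simpa [t] using hit
      refine ⟨i, hi'.1, ?_⟩
      have h1 : σ' ζ = ζ i / c i := (min_eq_left h).trans hi
      have h2 : raw ζ i = 0 := by
        simp only [raw, h1]
        rw [div_mul_cancel₀ _ (hcpos i hi'.1 hi'.2).ne', sub_self]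
      simp [ρ, h2]
    · left
      refine ⟨(hρT ζ hζ).1, ?_⟩
      show lowSum m (ρ ζ) ≤ N
      have h1 : σ' ζ = max (lowSum m ζ - N) 0 := min_eq_right h
      rw [hρlow]
      linarith [hlowle ζ hζ.1, le_max_left (lowSum m ζ - N) 0]
  · have hζT : ζ ∈ linkSlice m := hζ.elim (fun h => h.1) fun h => h.1.1
    have h1 : σ' ζ = 0 := by
      refine le_antisymm ?_ (hσ0 ζ hζT)
      rcases hζ with h | h
      · exact (min_le_right _ _).trans (max_le (sub_nonpos.2 h.2) le_rfl)
      · obtain ⟨i, hik, hi⟩ := h.1.2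
        have him : i ≠ m := by
          rintro rfl
          exact one_ne_zero (hζT.2.1.symm.trans hi)
        refine (min_le_left _ _).trans ((Finset.inf'_le (b := i) _ ?_).trans ?_)
        · simp [t, hik, him]
        · simp [hi]
    have h2 : raw ζ = ζ := by
      ext i
      simp [raw, h1]
    ext i
    simp [ρ, h2, hζT.2.2]

end ConeExtension

section ConeExtension

variable {n : ℕ}

/-- Lifting over the whole link slice, obtained by exhausting it by the truncated slices. -/
theorem IsSerreFibration.extend_linkSlice {P X : Type*} [TopologicalSpace X] {s : X → P} {p q : P}
    (hπ : IsSerreFibration (pairHolinkEv0 s p q)) {k m : Fin (n + 1)} (hk : 0 < k) (hkm : k ≤ m)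
    {b : (Fin (n + 1) → ℝ) → X} (hb : ContinuousOn b (linkSlice m))
    (hbp : ∀ ζ ∈ linkSlice m, s (b ζ) = p)
    {e : (Fin (n + 1) → ℝ) × ℝ → X} (he : ContinuousOn e (hornSlice m k ×ˢ Icc 0 1))
    (he0 : ∀ ζ ∈ hornSlice m k, e (ζ, 0) = b ζ)
    (heq : ∀ ζ ∈ hornSlice m k, ∀ v ∈ Ioc (0 : ℝ) 1, s (e (ζ, v)) = q) :
    ∃ g : (Fin (n + 1) → ℝ) × ℝ → X, ContinuousOn g (linkSlice m ×ˢ Icc 0 1) ∧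
      (∀ ζ ∈ linkSlice m, g (ζ, 0) = b ζ) ∧
      (∀ ζ ∈ linkSlice m, ∀ v ∈ Ioc (0 : ℝ) 1, s (g (ζ, v)) = q) ∧
      ∀ ζ ∈ hornSlice m k, ∀ v ∈ Icc (0 : ℝ) 1, g (ζ, v) = e (ζ, v) := by
  let Good : ℕ → ((Fin (n + 1) → ℝ) × ℝ → X) → Prop := fun N g =>
    ContinuousOn g (truncSlice m N ×ˢ Icc 0 1) ∧ (∀ ζ ∈ truncSlice m N, g (ζ, 0) = b ζ) ∧
      (∀ ζ ∈ truncSlice m N, ∀ v ∈ Ioc (0 : ℝ) 1, s (g (ζ, v)) = q) ∧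
      ∀ ζ ∈ hornSlice m k ∩ truncSlice m N, ∀ v ∈ Icc (0 : ℝ) 1, g (ζ, v) = e (ζ, v)
  have hzero : truncSlice m 0 ⊆ hornSlice m k := by
    intro ζ hζ
    refine ⟨hζ.1, 0, hk.ne, le_antisymm ?_ (hζ.1.1 0)⟩
    have h1 : lowSum m ζ ≤ (0 : ℕ) := hζ.2
    exact (le_lowSum hζ.1.1 (hk.trans_le hkm)).trans (by simpa using h1)
  have good_zero : Good 0 e :=
    ⟨he.mono (prod_mono_left hzero), fun ζ hζ => he0 ζ (hzero hζ), fun ζ hζ => heq ζ (hzero hζ),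
      fun ζ _ v _ => rfl⟩
  have step : ∀ N g, Good N g → ∃ g', Good (N + 1) g' ∧
      ∀ ζ ∈ truncSlice m N, ∀ v ∈ Icc (0 : ℝ) 1, g' (ζ, v) = g (ζ, v) := by
    rintro N g ⟨hg, hg0, hgq, hge⟩
    obtain ⟨ρ, hρ, hρm, hρid⟩ := exists_retraction_truncSlice m hk hkm N
    classical
    let e' : (Fin (n + 1) → ℝ) × ℝ → X := fun z => if z.1 ∈ truncSlice m N then g z else e z
    have he'g : ∀ ζ ∈ truncSlice m N, ∀ v, e' (ζ, v) = g (ζ, v) := fun ζ hζ v => if_pos hζ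
    have he'e : ∀ ζ ∈ hornSlice m k, ∀ v ∈ Icc (0 : ℝ) 1, e' (ζ, v) = e (ζ, v) := by
      intro ζ hζ v hv
      by_cases h : ζ ∈ truncSlice m N
      · rw [he'g ζ h, hge ζ ⟨hζ, h⟩ v hv]
      · exact if_neg h
    have hcont : ContinuousOn e'
        ((truncSlice m N ∪ (hornSlice m k ∩ truncSlice m (N + 1))) ×ˢ Icc 0 1) := by
      rw [union_prod]
      refine ContinuousOn.union_of_isClosed ?_ ?_ ((isClosed_truncSlice m N).prod isClosed_Icc)
        (((isClosed_hornSlice m k).inter (isClosed_truncSlice m _)).prod isClosed_Icc)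
      · exact hg.congr fun z hz => he'g z.1 hz.1 z.2
      · exact (he.mono (prod_mono_left inter_subset_left)).congr
          fun z hz => he'e z.1 hz.1.1 z.2 hz.2
    have hmem0 : (0 : ℝ) ∈ Icc (0 : ℝ) 1 := left_mem_Icc.2 zero_le_one
    obtain ⟨g', hg', hg'0, hg'q, hg'e⟩ := hπ.extend_exitPaths (isCompact_truncSlice m (N + 1))
      (convex_truncSlice m _) hρ hρm
      (union_subset (truncSlice_mono m N.le_succ) inter_subset_right) hρid
      (hb.mono fun ζ hζ => hζ.1) (fun ζ hζ => hbp ζ hζ.1) hcont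
      (fun ζ hζ => hζ.elim (fun h => (he'g ζ h 0).trans (hg0 ζ h))
        fun h => (he'e ζ h.1 0 hmem0).trans (he0 ζ h.1))
      (fun ζ hζ v hv => hζ.elim (fun h => (congrArg s (he'g ζ h v)).trans (hgq ζ h v hv))
        fun h => (congrArg s (he'e ζ h.1 v (Ioc_subset_Icc_self hv))).trans (heq ζ h.1 v hv))
    exact ⟨g', ⟨hg', hg'0, hg'q, fun ζ hζ v hv =>
      (hg'e ζ (Or.inr hζ) v hv).trans (he'e ζ hζ.1 v hv)⟩, fun ζ hζ v hv =>
      (hg'e ζ (Or.inl hζ) v hv).trans (he'g ζ hζ v)⟩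
  choose next hnext hnext' using step
  let G : (N : ℕ) → {g // Good N g} :=
    Nat.rec ⟨e, good_zero⟩ fun N g => ⟨next N g.1 g.2, hnext N g.1 g.2⟩
  have hGmono : ∀ N M, N ≤ M → ∀ ζ ∈ truncSlice m N, ∀ v ∈ Icc (0 : ℝ) 1,
      (G M).1 (ζ, v) = (G N).1 (ζ, v) := by
    intro N M hNM ζ hζ v hv
    induction M, hNM using Nat.le_induction with
    | base => rfl
    | succ M hNM ih =>
      exact (hnext' M (G M).1 (G M).2 ζ (truncSlice_mono m hNM hζ) v hv).trans ih
  have hmem : ∀ ζ ∈ linkSlice m, ζ ∈ truncSlice m ⌈lowSum m ζ⌉₊ := fun ζ hζ =>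
    ⟨hζ, Nat.le_ceil _⟩
  refine ⟨fun z => (G ⌈lowSum m z.1⌉₊).1 z, ?_, fun ζ hζ => (G _).2.2.1 ζ (hmem ζ hζ),
    fun ζ hζ => (G _).2.2.2.1 ζ (hmem ζ hζ), fun ζ hζ => (G _).2.2.2.2 ζ ⟨hζ, hmem ζ hζ.1⟩⟩
  rintro ⟨ζ, v⟩ ⟨hζ, hv⟩
  let N := ⌈lowSum m ζ⌉₊ + 1
  have hlt : lowSum m ζ < N := (Nat.le_ceil _).trans_lt (by simp [N])
  have hU : {z : (Fin (n + 1) → ℝ) × ℝ | lowSum m z.1 < N} ∈ nhds (ζ, v) :=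
    (isOpen_lt ((continuous_lowSum m).comp continuous_fst) continuous_const).mem_nhds hlt
  have heqN : ∀ z ∈ linkSlice m ×ˢ Icc (0 : ℝ) 1, lowSum m z.1 < N →
      (G ⌈lowSum m z.1⌉₊).1 z = (G N).1 z := fun z hz hzN =>
    (hGmono _ N (Nat.ceil_le.2 hzN.le) z.1 (hmem _ hz.1) z.2 hz.2).symm
  have h1 := (G N).2.1 (ζ, v) ⟨⟨hζ, hlt.le⟩, hv⟩
  have h2 : ContinuousWithinAt (G N).1 (linkSlice m ×ˢ Icc 0 1) (ζ, v) := by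
    refine h1.mono_of_mem_nhdsWithin ?_
    filter_upwards [self_mem_nhdsWithin, mem_nhdsWithin_of_mem_nhds hU] with z hz hzU
    exact ⟨⟨hz.1, le_of_lt hzU⟩, hz.2⟩
  refine h2.congr_of_eventuallyEq ?_ (heqN _ ⟨hζ, hv⟩ hlt)
  filter_upwards [self_mem_nhdsWithin, mem_nhdsWithin_of_mem_nhds hU] with z hz hzU
  exact heqN z hz hzU

variable (m : Fin (n + 1))

/-- The cone over the link slice: the vectors with `m`-th coordinate `1` whose later coordinates
sum up to at most `1`. -/
def linkCone : Set (Fin (n + 1) → ℝ) := {c | (∀ i, 0 ≤ c i) ∧ c m = 1 ∧ highSum m c ≤ 1}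

variable {m}

theorem IsSerreFibration.extend_linkCone {P X : Type*} [TopologicalSpace X] {s : X → P} {p q : P}
    (hπ : IsSerreFibration (pairHolinkEv0 s p q)) {k : Fin (n + 1)} (hk : 0 < k) (hkm : k ≤ m)
    (hmn : m < Fin.last n) {f : (Fin (n + 1) → ℝ) → X}
    (hf : ContinuousOn f {c ∈ linkCone m | ∃ i, i ≠ k ∧ c i = 0})
    (hfp : ∀ c ∈ linkCone m, highSum m c = 0 → s (f c) = p)
    (hfq : ∀ c ∈ linkCone m, (∃ i, i ≠ k ∧ c i = 0) → 0 < highSum m c → s (f c) = q) :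
    ∃ g : (Fin (n + 1) → ℝ) → X, ContinuousOn g (linkCone m) ∧
      (∀ c ∈ linkCone m, (∃ i, i ≠ k ∧ c i = 0) → g c = f c) ∧
      ∀ c ∈ linkCone m, 0 < highSum m c → s (g c) = q := by
  -- `Q (ζ, v)` lies at height `v` on the ray through `ζ`.
  let Q : (Fin (n + 1) → ℝ) × ℝ → (Fin (n + 1) → ℝ) := fun z i =>
    if m < i then z.2 * z.1 i else z.1 i
  have hQ : Continuous Q := by
    refine continuous_pi fun i => ?_
    by_cases hi : m < i
    · simp only [Q, hi, if_true]
      fun_prop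
    · simp only [Q, hi, if_false]
      fun_prop
  have hQhigh : ∀ z, highSum m (Q z) = z.2 * highSum m z.1 := by
    intro z
    simp only [highSum, Finset.mul_sum]
    exact Finset.sum_congr rfl fun i hi => if_pos (Finset.mem_Ioi.1 hi)
  have hQC : ∀ ζ ∈ linkSlice m, ∀ v ∈ Icc (0 : ℝ) 1, Q (ζ, v) ∈ linkCone m := by
    intro ζ hζ v hv
    refine ⟨fun i => ?_, ?_, ?_⟩
    · have := hζ.1 i
      have := hv.1
      simp only [Q]
      split_ifs <;> positivity
    · simp [Q, hζ.2.1]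
    · rw [hQhigh, hζ.2.2, mul_one]
      exact hv.2
  have hmem0 : (0 : ℝ) ∈ Icc (0 : ℝ) 1 := left_mem_Icc.2 zero_le_one
  have hhorn : ∀ c : Fin (n + 1) → ℝ, (∀ i, 0 ≤ c i) → highSum m c = 0 → ∃ i, i ≠ k ∧ c i = 0 :=
    fun c hc h => ⟨Fin.last n, (hkm.trans_lt hmn).ne', (highSum_eq_zero_iff hc).1 h _ hmn⟩
  have hQhorn : ∀ ζ ∈ hornSlice m k, ∀ v, ∃ i, i ≠ k ∧ Q (ζ, v) i = 0 := by
    rintro ζ ⟨hζ, i, hi, hi0⟩ v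
    exact ⟨i, hi, by simp [Q, hi0]⟩
  have hQ0 : ∀ ζ ∈ linkSlice m, highSum m (Q (ζ, 0)) = 0 := fun ζ _ => by rw [hQhigh, zero_mul]
  obtain ⟨g, hg, hg0, hgq, hge⟩ := hπ.extend_linkSlice hk hkm (b := fun ζ => f (Q (ζ, 0)))
    (e := fun z => f (Q z))
    (hf.comp (hQ.comp (by fun_prop)).continuousOn fun ζ hζ =>
      ⟨hQC ζ hζ 0 hmem0, hhorn _ (hQC ζ hζ 0 hmem0).1 (hQ0 ζ hζ)⟩)
    (fun ζ hζ => hfp _ (hQC ζ hζ 0 hmem0) (hQ0 ζ hζ))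
    (hf.comp hQ.continuousOn fun z hz => ⟨hQC z.1 hz.1.1 z.2 hz.2, hQhorn z.1 hz.1 z.2⟩)
    (fun ζ _ => rfl)
    (fun ζ hζ v hv => by
      refine hfq _ (hQC ζ hζ.1 v (Ioc_subset_Icc_self hv)) (hQhorn ζ hζ v) ?_
      rw [hQhigh, hζ.1.2.2, mul_one]
      exact hv.1)
  -- The direction of the later coordinates is discontinuous at the base of the cone.
  let K : Set (Fin (n + 1) → ℝ) := stdSimplex ℝ (Fin (n + 1)) ∩ {y | highSum m y = 1}
  have hK : IsCompact K :=
    (isCompact_stdSimplex ℝ _).inter_right (isClosed_eq (continuous_highSum m) continuous_const)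
  let mix : (Fin (n + 1) → ℝ) × (Fin (n + 1) → ℝ) → (Fin (n + 1) → ℝ) := fun z i =>
    if m < i then z.2 i else z.1 i
  have hmix : Continuous mix := by
    refine continuous_pi fun i => ?_
    by_cases hi : m < i
    · simp only [mix, hi, if_true]
      fun_prop
    · simp only [mix, hi, if_false]
      fun_prop
  have hmixhigh : ∀ z, highSum m (mix z) = highSum m z.2 := fun z =>
    Finset.sum_congr rfl fun i hi => if_pos (Finset.mem_Ioi.1 hi)
  have hmixT : ∀ c ∈ linkCone m, ∀ y ∈ K, mix (c, y) ∈ linkSlice m := by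
    intro c hc y hy
    refine ⟨fun i => ?_, ?_, (hmixhigh _).trans hy.2⟩
    · have := hc.1 i
      have := hy.1.1 i
      simp only [mix]
      split_ifs <;> assumption
    · simp [mix, hc.2.1]
  let y : (Fin (n + 1) → ℝ) → (Fin (n + 1) → ℝ) := fun c =>
    if highSum m c = 0 then Pi.single (Fin.last n) 1
    else fun i => if m < i then c i / highSum m c else 0
  have hyK : MapsTo y (linkCone m) K := by
    intro c hc
    by_cases h : highSum m c = 0
    · have : y c = Pi.single (Fin.last n) 1 := if_pos h
      rw [this]
      refine ⟨single_mem_stdSimplex ℝ _, ?_⟩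
      show highSum m _ = 1
      simp [highSum, hmn]
    · have hyc : y c = fun i => if m < i then c i / highSum m c else 0 := if_neg h
      have h1 : highSum m (y c) = 1 := by
        have : highSum m (y c) = highSum m c / highSum m c := by
          conv_rhs => rw [highSum, Finset.sum_div]
          rw [hyc]
          exact Finset.sum_congr rfl fun i hi => if_pos (Finset.mem_Ioi.1 hi)
        rw [this, div_self h]
      refine ⟨⟨fun i => ?_, ?_⟩, h1⟩
      · have := hc.1 i
        have := highSum_nonneg (m := m) hc.1
        rw [hyc]
        simp only
        split_ifs <;> positivity
      · have h2 : lowSum m (y c) = 0 := by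
          rw [hyc]
          exact Finset.sum_eq_zero fun i hi => if_neg (Finset.mem_Iio.1 hi).not_gt
        have h3 : y c m = 0 := by simp [hyc]
        rw [sum_eq_lowSum_add_highSum m, h1, h2, h3]
        norm_num
  have hQmix : ∀ c ∈ linkCone m, Q (mix (c, y c), highSum m c) = c := by
    intro c hc
    ext i
    by_cases hi : m < i
    · by_cases h : highSum m c = 0
      · simp [Q, hi, h, (highSum_eq_zero_iff hc.1).1 h i hi]
      · have hyc : y c = fun i => if m < i then c i / highSum m c else 0 := if_neg h
        simp only [Q, mix, hi, if_true, hyc]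
        field_simp
    · simp [Q, mix, hi]
  have hheight : ∀ c ∈ linkCone m, highSum m c ∈ Icc (0 : ℝ) 1 := fun c hc =>
    ⟨highSum_nonneg hc.1, hc.2.2⟩
  refine ⟨fun c => g (mix (c, y c), highSum m c), ?_, fun c hc hck => ?_, fun c hc hpos =>
    hgq _ (hmixT c hc _ (hyK hc)) _ ⟨hpos, hc.2.2⟩⟩
  · refine ContinuousOn.of_continuousWithinAt_or_const (Ψ := fun z => g (mix z, highSum m z.1)) ?_
      hK hyK fun c hc => ?_
    · refine hg.comp (hmix.prodMk ((continuous_highSum m).comp continuous_fst)).continuousOn ?_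
      exact fun z hz => ⟨hmixT _ hz.1 _ hz.2, hheight _ hz.1⟩
    · by_cases h : highSum m c = 0
      · right
        have key : ∀ w ∈ K, g (mix (c, w), highSum m c) = f c := by
          intro w hw
          rw [h, hg0 _ (hmixT c hc w hw)]
          congr 1
          ext i
          by_cases hi : m < i
          · simp [Q, hi, (highSum_eq_zero_iff hc.1).1 h i hi]
          · simp [Q, mix, hi]
        exact fun w hw => (key w hw).trans (key _ (hyK hc)).symm
      · left
        have hne : ∀ᶠ c' in nhds c, highSum m c' ≠ 0 :=
          (continuous_highSum m).continuousAt.eventually_ne h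
        have h1 : ContinuousAt (fun c' : Fin (n + 1) → ℝ =>
            fun i => if m < i then c' i / highSum m c' else 0) c := by
          refine continuousAt_pi.2 fun i => ?_
          by_cases hi : m < i
          · simp only [hi, if_true]
            exact (continuous_apply i).continuousAt.div (continuous_highSum m).continuousAt h
          · simp only [hi, if_false]
            exact continuousAt_const
        refine (h1.congr ?_).continuousWithinAt
        filter_upwards [hne] with c' hc'
        exact (if_neg hc').symm
  · by_cases h : highSum m c = 0
    · have h1 := hQmix c hc
      rw [h] at h1
      simp only [h]
      rw [hg0 _ (hmixT c hc _ (hyK hc)), h1]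
    · have h1 : mix (c, y c) ∈ hornSlice m k := by
        refine ⟨hmixT c hc _ (hyK hc), ?_⟩
        obtain ⟨i, hi, hi0⟩ := hck
        have hyc : y c = fun i => if m < i then c i / highSum m c else 0 := if_neg h
        exact ⟨i, hi, by simp [mix, hyc, hi0]⟩
      simp only
      rw [hge _ h1 _ (hheight c hc), hQmix c hc]

/-- Extension, near the open stratum of the vertex `m`, of a map defined on a horn. -/
theorem IsSerreFibration.extend_stdSimplex {P X : Type*} [TopologicalSpace X] {s : X → P} {p q : P}
    (hπ : IsSerreFibration (pairHolinkEv0 s p q)) {k : Fin (n + 1)} (hk : 0 < k) (hkm : k ≤ m)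
    (hmn : m < Fin.last n) {f : (Fin (n + 1) → ℝ) → X}
    (hf : ContinuousOn f {z ∈ stdSimplex ℝ (Fin (n + 1)) | (∃ i, i ≠ k ∧ z i = 0) ∧ 0 < z m})
    (hfp : ∀ z ∈ stdSimplex ℝ (Fin (n + 1)), 0 < z m → highSum m z = 0 → s (f z) = p)
    (hfq : ∀ z ∈ stdSimplex ℝ (Fin (n + 1)), (∃ i, i ≠ k ∧ z i = 0) → 0 < highSum m z →
      s (f z) = q) :
    ∃ g : (Fin (n + 1) → ℝ) → X,
      ContinuousOn g {z ∈ stdSimplex ℝ (Fin (n + 1)) | 0 < z m ∧ highSum m z ≤ z m} ∧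
      (∀ z ∈ stdSimplex ℝ (Fin (n + 1)), 0 < z m → highSum m z ≤ z m →
        (∃ i, i ≠ k ∧ z i = 0) → g z = f z) ∧
      ∀ z ∈ stdSimplex ℝ (Fin (n + 1)), 0 < z m → highSum m z ≤ z m → 0 < highSum m z →
        s (g z) = q := by
  have hhigh : ∀ (a : ℝ) (z : Fin (n + 1) → ℝ), highSum m (a • z) = a * highSum m z := fun a z => by
    simp [highSum, Finset.mul_sum]
  have hsum1 : ∀ c ∈ linkCone m, 1 ≤ ∑ i, c i := fun c hc =>
    hc.2.1 ▸ Finset.single_le_sum (fun i _ => hc.1 i) (Finset.mem_univ m)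
  have hmem : ∀ c ∈ linkCone m, (∑ i, c i)⁻¹ • c ∈ stdSimplex ℝ (Fin (n + 1)) := by
    intro c hc
    have h1 := hsum1 c hc
    refine ⟨fun i => ?_, ?_⟩
    · have := hc.1 i
      simp only [Pi.smul_apply, smul_eq_mul]
      positivity
    · simp only [Pi.smul_apply, smul_eq_mul, ← Finset.mul_sum]
      exact inv_mul_cancel₀ (by positivity)
  have hpos : ∀ c ∈ linkCone m, 0 < ((∑ i, c i)⁻¹ • c) m := by
    intro c hc
    have h1 := hsum1 c hc
    simp only [Pi.smul_apply, smul_eq_mul, hc.2.1]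
    positivity
  have hhorn : ∀ (a : ℝ) (c : Fin (n + 1) → ℝ), (∃ i, i ≠ k ∧ c i = 0) →
      ∃ i, i ≠ k ∧ (a • c) i = 0 := fun a c ⟨i, hi, hi0⟩ => ⟨i, hi, by simp [hi0]⟩
  obtain ⟨g, hg, hgf, hgq⟩ := hπ.extend_linkCone hk hkm hmn
    (f := fun c => f ((∑ i, c i)⁻¹ • c))
    (hf.comp (ContinuousOn.smul (ContinuousOn.inv₀ (by fun_prop) fun c hc =>
      (one_pos.trans_le (hsum1 c hc.1)).ne') continuousOn_id) fun c hc =>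
      ⟨hmem c hc.1, hhorn _ c hc.2, hpos c hc.1⟩)
    (fun c hc h => hfp _ (hmem c hc) (hpos c hc) (by rw [hhigh, h, mul_zero]))
    (fun c hc hck h => hfq _ (hmem c hc) (hhorn _ c hck) (by
      have h1 := hsum1 c hc
      rw [hhigh]
      positivity))
  have hcone : ∀ z ∈ stdSimplex ℝ (Fin (n + 1)), 0 < z m → highSum m z ≤ z m →
      (z m)⁻¹ • z ∈ linkCone m := by
    intro z hz hzm hle
    refine ⟨fun i => ?_, ?_, ?_⟩
    · have := hz.1 i
      simp only [Pi.smul_apply, smul_eq_mul]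
      positivity
    · simp [hzm.ne']
    · rw [hhigh, inv_mul_le_iff₀ hzm, mul_one]
      exact hle
  refine ⟨fun z => g ((z m)⁻¹ • z), ?_, fun z hz hzm hle hzk => ?_, fun z hz hzm hle h =>
    hgq _ (hcone z hz hzm hle) (by rw [hhigh]; positivity)⟩
  · refine hg.comp (fun z hz => ?_) fun z hz => hcone z hz.1 hz.2.1 hz.2.2
    exact ((continuous_apply m).continuousAt.inv₀ hz.2.1.ne').continuousWithinAt.smul
      continuousWithinAt_id
  · simp only
    rw [hgf _ (hcone z hz hzm hle) (hhorn _ z hzk)]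
    congr 1
    have : ∑ i, ((z m)⁻¹ • z) i = (z m)⁻¹ := by
      simp only [Pi.smul_apply, smul_eq_mul, ← Finset.mul_sum]
      rw [hz.2, mul_one]
    rw [this, inv_inv, smul_smul, mul_inv_cancel₀ hzm.ne', one_smul]

end ConeExtension

theorem ContinuousOn.ite_le {α X : Type*} [TopologicalSpace α] [TopologicalSpace X] {S : Set α}
    {a b : α → ℝ} {f g : α → X} (ha : ContinuousOn a S) (hb : ContinuousOn b S)
    (hf : ContinuousOn f {x ∈ S | a x ≤ b x}) (hg : ContinuousOn g {x ∈ S | b x ≤ a x})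
    (hfg : ∀ x ∈ S, a x = b x → f x = g x) :
    ContinuousOn (fun x => if a x ≤ b x then f x else g x) S := by
  rw [continuousOn_iff_continuous_domRestrict] at ha hb ⊢
  refine continuous_if_le ha hb (hf.comp continuous_subtype_val.continuousOn fun x hx => ⟨x.2, hx⟩)
    (hg.comp continuous_subtype_val.continuousOn fun x hx => ⟨x.2, hx⟩) fun x => hfg x.1 x.2

section Homotopy

variable {α X P : Type*} [TopologicalSpace X] {s : X → P} {q : P} {L : Set α}
  {F : α → X}

/-- Concatenation of a homotopy `h`, run at speed `(δ z)⁻¹`, with a homotopy `κ`. -/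
theorem exists_concat_homotopy [TopologicalSpace α] {D : Set α} {δ : α → ℝ} (hDL : D ⊆ L)
    (hδ : Continuous δ) (hδ0 : ∀ z ∈ L, 0 ≤ δ z) {h κ : α × ℝ → X}
    (hh : ContinuousOn h (L ×ˢ Icc 0 1)) (hh0 : ∀ z ∈ L, h (z, 0) = F z)
    (hhδ : ∀ z ∈ L, δ z = 0 → ∀ u ∈ Icc (0 : ℝ) 1, h (z, u) = F z)
    (hhq : ∀ z ∈ L, 0 < δ z → ∀ u ∈ Ioc (0 : ℝ) 1, s (h (z, u)) = q)
    (hκ : ContinuousOn κ (D ×ˢ Icc 0 1)) (hκ0 : ∀ z ∈ D, κ (z, 0) = h (z, 1))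
    (hκq : ∀ z ∈ D, ∀ u ∈ Ioc (0 : ℝ) 1, s (κ (z, u)) = q) :
    ∃ h' : α × ℝ → X, ContinuousOn h' (D ×ˢ Icc 0 1) ∧ (∀ z ∈ D, h' (z, 0) = F z) ∧
      ∀ z ∈ D, ∀ u ∈ Ioc (0 : ℝ) 1, s (h' (z, u)) = q := by
  have hδ1 : Continuous fun w : α × ℝ => δ w.1 := hδ.comp continuous_fst
  refine ⟨fun w => if w.2 ≤ δ w.1 then h (w.1, w.2 / δ w.1) else κ (w.1, w.2 - δ w.1),
    ContinuousOn.ite_le continuousOn_snd hδ1.continuousOn ?_ ?_ ?_, fun z hz => ?_,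
    fun z hz u hu => ?_⟩
  · refine ContinuousOn.of_continuousWithinAt_or_const (Ψ := fun w => h (w.1.1, w.2))
      (K := Icc (0 : ℝ) 1) (y := fun w : α × ℝ => w.2 / δ w.1) ?_ isCompact_Icc
      (fun w hw => ⟨div_nonneg hw.1.2.1 (hδ0 _ (hDL hw.1.1)),
        div_le_one_of_le₀ hw.2 (hδ0 _ (hDL hw.1.1))⟩) fun w hw => ?_
    · exact hh.comp (Continuous.continuousOn (by fun_prop)) fun w hw => ⟨hDL hw.1.1.1, hw.2⟩
    · by_cases hw0 : δ w.1 = 0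
      · right
        intro v hv
        simp only [hw0, div_zero]
        rw [hhδ _ (hDL hw.1.1) hw0 v hv, hh0 _ (hDL hw.1.1)]
      · exact Or.inl (continuous_snd.continuousAt.div hδ1.continuousAt hw0).continuousWithinAt
  · refine hκ.comp (Continuous.continuousOn (by fun_prop)) fun w hw => ⟨hw.1.1, ?_⟩
    exact ⟨sub_nonneg.2 hw.2, (sub_le_self _ (hδ0 _ (hDL hw.1.1))).trans hw.1.2.2⟩
  · intro w hw h1
    rw [h1, sub_self, hκ0 _ hw.1]
    by_cases hw0 : δ w.1 = 0
    · rw [hw0, div_zero, hh0 _ (hDL hw.1), hhδ _ (hDL hw.1) hw0 _ (right_mem_Icc.2 zero_le_one)]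
    · rw [div_self hw0]
  · simp only [hδ0 z (hDL hz), if_true, zero_div, hh0 z (hDL hz)]
  · simp only
    split_ifs with hle
    · have hpos : 0 < δ z := hu.1.trans_le hle
      exact hhq z (hDL hz) hpos _ ⟨div_pos hu.1 hpos, (div_le_one hpos).2 hle⟩
    · exact hκq z hz _ ⟨sub_pos.2 (not_le.1 hle),
        (sub_le_self _ (hδ0 z (hDL hz))).trans hu.2⟩

/-- A homotopy defined over the open locus `0 < θ` may be slowed down so that it extends by the
constant homotopy. -/
theorem exists_damped_homotopy [MetricSpace α] [TopologicalSpace.MetrizableSpace X]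
    (hF : ContinuousOn F L) {θ : α → ℝ} (hθ : Continuous θ) (hθ0 : ∀ z ∈ L, 0 ≤ θ z)
    {h : α × ℝ → X} (hh : ContinuousOn h ({z ∈ L | 0 < θ z} ×ˢ Icc 0 1))
    (hh0 : ∀ z ∈ L, 0 < θ z → h (z, 0) = F z)
    (hhq : ∀ z ∈ L, 0 < θ z → ∀ u ∈ Ioc (0 : ℝ) 1, s (h (z, u)) = q) :
    ∃ h' : α × ℝ → X, ContinuousOn h' (L ×ˢ Icc 0 1) ∧ (∀ z ∈ L, h' (z, 0) = F z) ∧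
      (∀ z ∈ L, θ z = 0 → ∀ u ∈ Icc (0 : ℝ) 1, h' (z, u) = F z) ∧
      ∀ z ∈ L, 0 < θ z → ∀ u ∈ Ioc (0 : ℝ) 1, s (h' (z, u)) = q := by
  let := TopologicalSpace.metrizableSpaceMetric X
  let D : Set α := {z ∈ L | 0 < θ z}
  let t : D → Set ℝ := fun z =>
    {ε | 0 < ε ∧ ε ≤ 1 ∧ ∀ u, 0 ≤ u → u ≤ ε → dist (h (z, u)) (F z) ≤ θ z}
  have ht : ∀ z, Convex ℝ (t z) := by
    intro z
    refine OrdConnected.convex ⟨?_⟩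
    rintro x ⟨hx, -, -⟩ y ⟨-, hy, hy'⟩ w ⟨hxw, hwy⟩
    exact ⟨hx.trans_le hxw, hwy.trans hy, fun u hu huw => hy' u hu (huw.trans hwy)⟩
  have hloc : ∀ z : D, ∃ c : ℝ, ∀ᶠ z' in nhds z, c ∈ t z' := by
    intro z
    have h1 : ContinuousOn (fun w : α × ℝ => dist (h w) (F w.1) - θ w.1) (D ×ˢ Icc 0 1) :=
      (continuous_dist.comp_continuousOn
        (hh.prodMk (hF.comp continuousOn_fst fun w hw => hw.1.1))).sub
        (hθ.comp continuous_fst).continuousOn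
    have h2 : dist (h (z.1, 0)) (F z) - θ z < 0 := by
      rw [hh0 z z.2.1 z.2.2, dist_self, zero_sub]
      exact neg_neg_of_pos z.2.2
    have h3 := (h1 (z.1, 0) ⟨z.2, left_mem_Icc.2 zero_le_one⟩).eventually (gt_mem_nhds h2)
    rw [nhdsWithin_prod_eq, Filter.eventually_prod_iff] at h3
    obtain ⟨pa, hpa, pb, hpb, hab⟩ := h3
    obtain ⟨ε, hε, hεb⟩ := Metric.mem_nhdsWithin_iff.1 hpb
    refine ⟨min 1 (ε / 2), ?_⟩
    have h4 : ∀ᶠ z' : D in nhds z, pa z' := by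
      rw [nhds_subtype_eq_comap_nhdsWithin]
      exact hpa.comap _
    filter_upwards [h4] with z' hz'
    refine ⟨by positivity, min_le_left _ _, fun u hu0 hu => ?_⟩
    have h5 : pb u := by
      refine hεb ⟨?_, hu0, hu.trans (min_le_left _ _)⟩
      rw [Metric.mem_ball, Real.dist_eq, sub_zero, abs_of_nonneg hu0]
      linarith [hu.trans (min_le_right _ _)]
    linarith [hab hz' h5]
  obtain ⟨ε, hε⟩ := exists_continuous_forall_mem_convex_of_local_const ht hloc
  classical
  let ε' : α → ℝ := fun z => if hz : z ∈ D then ε ⟨z, hz⟩ else 1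
  have hε't : ∀ z (hz : z ∈ D), ε' z ∈ t ⟨z, hz⟩ := fun z hz => by
    simp only [ε', hz, dif_pos]
    exact hε _
  have hε' : ContinuousOn ε' D := by
    rw [continuousOn_iff_continuous_domRestrict]
    refine ε.continuous.congr fun z => ?_
    simp [ε', domRestrict_apply]
  have hεI : ∀ z ∈ D, ∀ u ∈ Icc (0 : ℝ) 1, ε' z * u ∈ Icc (0 : ℝ) 1 := fun z hz u hu =>
    ⟨mul_nonneg (hε't z hz).1.le hu.1, mul_le_one₀ (hε't z hz).2.1 hu.1 hu.2⟩
  let h' : α × ℝ → X := fun w => if 0 < θ w.1 then h (w.1, ε' w.1 * w.2) else F w.1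
  have hdist : ∀ w ∈ L ×ˢ Icc (0 : ℝ) 1, dist (h' w) (F w.1) ≤ θ w.1 := by
    rintro ⟨z, u⟩ ⟨hz, hu⟩
    by_cases hz0 : 0 < θ z
    · have h1 := hε't z ⟨hz, hz0⟩
      simp only [h', hz0, if_true]
      exact h1.2.2 _ (mul_nonneg h1.1.le hu.1) (mul_le_of_le_one_right h1.1.le hu.2)
    · simp only [h', hz0, if_false, dist_self]
      exact hθ0 z hz
  refine ⟨h', ?_, fun z hz => ?_, fun z hz hz0 u _ => ?_, fun z hz hz0 u hu => ?_⟩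
  · rintro ⟨z, u⟩ ⟨hz, hu⟩
    rcases (hθ0 z hz).eq_or_lt with hz0 | hz0
    · have hz' : h' (z, u) = F z := by simp [h', ← hz0]
      rw [ContinuousWithinAt, hz', tendsto_iff_dist_tendsto_zero]
      have hFL : ContinuousWithinAt (fun w : α × ℝ => F w.1) (L ×ˢ Icc 0 1) (z, u) :=
        (hF z hz).comp continuousWithinAt_fst fun w hw => hw.1
      have h1 : ContinuousWithinAt (fun w : α × ℝ => θ w.1 + dist (F w.1) (F z))
          (L ×ˢ Icc 0 1) (z, u) :=
        (hθ.comp continuous_fst).continuousWithinAt.add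
          (hFL.dist continuousWithinAt_const)
      have h2 : Filter.Tendsto (fun w : α × ℝ => θ w.1 + dist (F w.1) (F z))
          (nhdsWithin (z, u) (L ×ˢ Icc 0 1)) (nhds 0) := by
        have h3 := h1.tendsto
        simpa [← hz0] using h3
      refine squeeze_zero' (Filter.Eventually.of_forall fun _ => dist_nonneg) ?_ h2
      filter_upwards [self_mem_nhdsWithin] with w hw
      linarith [dist_triangle (h' w) (F w.1) (F z), hdist w hw]
    · have hU : {w : α × ℝ | 0 < θ w.1} ∈ nhds (z, u) :=
        (isOpen_lt continuous_const (hθ.comp continuous_fst)).mem_nhds hz0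
      have h1 : ContinuousOn (fun w : α × ℝ => h (w.1, ε' w.1 * w.2)) (D ×ˢ Icc 0 1) := by
        refine hh.comp (continuousOn_fst.prodMk
          ((hε'.comp continuousOn_fst fun w hw => hw.1).mul continuousOn_snd)) fun w hw => ?_
        exact ⟨hw.1, hεI _ hw.1 _ hw.2⟩
      have h2 : ContinuousWithinAt (fun w : α × ℝ => h (w.1, ε' w.1 * w.2))
          (L ×ˢ Icc 0 1) (z, u) := by
        refine (h1 (z, u) ⟨⟨hz, hz0⟩, hu⟩).mono_of_mem_nhdsWithin ?_
        filter_upwards [self_mem_nhdsWithin, mem_nhdsWithin_of_mem_nhds hU] with w hw hwU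
        exact ⟨⟨hw.1, hwU⟩, hw.2⟩
      refine h2.congr_of_eventuallyEq ?_ (if_pos hz0)
      filter_upwards [mem_nhdsWithin_of_mem_nhds hU] with w hwU
      exact if_pos hwU
  · by_cases hz0 : 0 < θ z
    · simp [h', hz0, hh0 z hz hz0]
    · simp [h', hz0]
  · simp [h', hz0]
  · have hzD : z ∈ D := ⟨hz, hz0⟩
    simp only [h', hz0, if_true]
    exact hhq z hz hz0 _ ⟨mul_pos (hε't z hzD).1 hu.1, (hεI z hzD u (Ioc_subset_Icc_self hu)).2⟩

end Homotopy

section PushOff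

variable {n : ℕ} {k : Fin (n + 1)} {P X : Type*} [TopologicalSpace X] {s : X → P}
  {F : (Fin (n + 1) → ℝ) → X}

/-- The `k`-th horn of the standard simplex, as a subset of the ambient vector space. -/
def stdHorn (k : Fin (n + 1)) : Set (Fin (n + 1) → ℝ) :=
  {z ∈ stdSimplex ℝ (Fin (n + 1)) | ∃ i, i ≠ k ∧ z i = 0}

/-- The map `F` on the horn may be deformed, relative to the zero locus of `θ`, by a homotopy which
immediately moves the complement of that locus into the `q`-stratum. -/
def HasPushOff (s : X → P) (q : P) (k : Fin (n + 1)) (F : (Fin (n + 1) → ℝ) → X)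
    (θ : (Fin (n + 1) → ℝ) → ℝ) : Prop :=
  ∃ h : (Fin (n + 1) → ℝ) × ℝ → X, ContinuousOn h (stdHorn k ×ˢ Icc 0 1) ∧
    (∀ z ∈ stdHorn k, h (z, 0) = F z) ∧
    (∀ z ∈ stdHorn k, θ z = 0 → ∀ u ∈ Icc (0 : ℝ) 1, h (z, u) = F z) ∧
    ∀ z ∈ stdHorn k, 0 < θ z → ∀ u ∈ Ioc (0 : ℝ) 1, s (h (z, u)) = q

lemma sum_add_smul_single_sub_single {z : Fin (n + 1) → ℝ} (c : ℝ) (i j : Fin (n + 1)) :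
    ∑ l, (z + c • (Pi.single i 1 - Pi.single j 1) : Fin (n + 1) → ℝ) l = ∑ l, z l := by
  simp [Finset.sum_add_distrib, ← Finset.mul_sum]

/-- The homotopy pushing the open star of a vertex `m ≥ k` of the horn into the top stratum. -/
theorem IsSerreFibration.exists_homotopy_star {p q : P}
    (hπ : IsSerreFibration (pairHolinkEv0 s p q)) {m : Fin (n + 1)} (hk : 0 < k)
    (hkm : k ≤ m) (hmn : m < Fin.last n) (hF : ContinuousOn F (stdHorn k))
    (hFp : ∀ z ∈ stdHorn k, 0 < z m → highSum m z = 0 → s (F z) = p)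
    (hFq : ∀ z ∈ stdHorn k, 0 < highSum m z → s (F z) = q) :
    ∃ κ : (Fin (n + 1) → ℝ) × ℝ → X,
      ContinuousOn κ ({z ∈ stdHorn k | 0 < z m + highSum m z} ×ˢ Icc 0 1) ∧
      (∀ z ∈ stdHorn k, 0 < z m + highSum m z → κ (z, 0) = F z) ∧
      ∀ z ∈ stdHorn k, 0 < z m + highSum m z → ∀ u ∈ Ioc (0 : ℝ) 1, s (κ (z, u)) = q := by
  obtain ⟨g, hg, hgF, hgq⟩ := hπ.extend_stdSimplex hk hkm hmn (f := F)
    (hF.mono fun z hz => ⟨hz.1, hz.2.1⟩)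
    (fun z hz hzm hz0 => hFp z ⟨hz, Fin.last n, (hkm.trans_lt hmn).ne',
      (highSum_eq_zero_iff hz.1).1 hz0 _ hmn⟩ hzm hz0)
    (fun z hz hzk hz0 => hFq z ⟨hz, hzk⟩ hz0)
  have hhs := continuous_highSum (n := n) m
  let e : Fin (n + 1) → ℝ := Pi.single (Fin.last n) 1 - Pi.single m 1
  let w : (Fin (n + 1) → ℝ) × ℝ → Fin (n + 1) → ℝ := fun a =>
    a.1 + (a.2 * (a.1 m - highSum m a.1) / 2) • e
  have hw : Continuous w := by fun_prop
  have hem : e m = -1 := by simp [e, hmn.ne]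
  have hel : e (Fin.last n) = 1 := by simp [e, hmn.ne']
  have heo : ∀ i, i ≠ m → 0 ≤ e i := by
    intro i hi
    simp only [e, Pi.sub_apply, Pi.single_apply, hi, if_false, sub_zero]
    split_ifs <;> norm_num
  have hwm : ∀ a, w a m = a.1 m - a.2 * (a.1 m - highSum m a.1) / 2 := by
    intro a
    simp only [w, Pi.add_apply, Pi.smul_apply, hem, smul_eq_mul]
    ring
  have hws : ∀ a, highSum m (w a) = highSum m a.1 + a.2 * (a.1 m - highSum m a.1) / 2 := by
    intro a
    have h1 : ∑ i ∈ Finset.Ioi m, e i = 1 := by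
      rw [Finset.sum_eq_single_of_mem (Fin.last n) (Finset.mem_Ioi.2 hmn), hel]
      intro i hi hil
      simp [e, hil, (Finset.mem_Ioi.1 hi).ne']
    simp only [highSum, w, Pi.add_apply, Pi.smul_apply, smul_eq_mul, Finset.sum_add_distrib,
      ← Finset.mul_sum, h1, mul_one]
  have hwmem : ∀ z ∈ stdHorn k, 0 < z m + highSum m z → highSum m z ≤ z m → ∀ u ∈ Icc (0 : ℝ) 1,
      w (z, u) ∈ stdSimplex ℝ (Fin (n + 1)) ∧ 0 < w (z, u) m ∧
        highSum m (w (z, u)) ≤ w (z, u) m := by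
    intro z hz h0 hle u hu
    have h1 : u * (z m - highSum m z) ≤ z m - highSum m z :=
      mul_le_of_le_one_left (sub_nonneg.2 hle) hu.2
    have h2 : 0 ≤ u * (z m - highSum m z) := mul_nonneg hu.1 (sub_nonneg.2 hle)
    have h3 : 0 < w (z, u) m := by rw [hwm]; simp only; linarith
    refine ⟨⟨fun i => ?_, ?_⟩, h3, ?_⟩
    · rcases eq_or_ne i m with rfl | hi
      · exact h3.le
      · simp only [w, Pi.add_apply, Pi.smul_apply, smul_eq_mul]
        have := mul_nonneg h2 (heo i hi)
        linarith [hz.1.1 i]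
    · simp only [w, e, sum_add_smul_single_sub_single]
      exact hz.1.2
    · rw [hwm, hws]
      simp only
      linarith
  have hFg : ∀ z ∈ stdHorn k, 0 < z m → highSum m z ≤ z m → g z = F z := fun z hz hzm hle =>
    hgF z hz.1 hzm hle hz.2
  refine ⟨fun a => if a.1 m ≤ highSum m a.1 then F a.1 else g (w a), ContinuousOn.ite_le
    (by fun_prop) (by fun_prop) (hF.comp continuousOn_fst fun a ha => ha.1.1.1)
    (hg.comp hw.continuousOn fun a ha => hwmem _ ha.1.1.1 ha.1.1.2 ha.2 _ ha.1.2) ?_, ?_, ?_⟩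
  · intro a ha h1
    have h2 : w a = a.1 := by simp [w, h1]
    have h3 := ha.1.2
    rw [h2, hFg _ ha.1.1 (by linarith) h1.ge]
  · intro z hz h0
    simp only
    split_ifs with h1
    · rfl
    · have h2 : w (z, 0) = z := by simp [w]
      rw [h2, hFg z hz (by linarith) (by linarith)]
  · intro z hz h0 u hu
    simp only
    split_ifs with h1
    · exact hFq z hz (by linarith)
    · obtain ⟨h2, h3, h4⟩ := hwmem z hz h0 (by linarith) u (Ioc_subset_Icc_self hu)
      refine hgq _ h2 h3 h4 ?_
      have h5 := mul_pos hu.1 (sub_pos.2 (not_le.1 h1))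
      rw [hws]
      simp only
      linarith [highSum_nonneg (m := m) hz.1.1]

/-- The homotopy pushing the open star of a vertex `m < k` of the horn towards the vertex `k`. -/
theorem exists_homotopy_star_of_lt {q : P} {m : Fin (n + 1)} (hkm : m < k)
    (hF : ContinuousOn F (stdHorn k)) (hFq : ∀ z ∈ stdHorn k, 0 < highSum m z → s (F z) = q) :
    ∃ κ : (Fin (n + 1) → ℝ) × ℝ → X, ContinuousOn κ (stdHorn k ×ˢ Icc 0 1) ∧
      (∀ z ∈ stdHorn k, κ (z, 0) = F z) ∧
      ∀ z ∈ stdHorn k, ∀ u ∈ Ioc (0 : ℝ) 1, s (κ (z, u)) = q := by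
  let w : (Fin (n + 1) → ℝ) × ℝ → Fin (n + 1) → ℝ := fun a =>
    (1 - a.2) • a.1 + a.2 • Pi.single k 1
  have hw : Continuous w := by fun_prop
  have hwmem : ∀ z ∈ stdHorn k, ∀ u ∈ Icc (0 : ℝ) 1, w (z, u) ∈ stdHorn k := by
    rintro z ⟨hz, i, hik, hi⟩ u hu
    refine ⟨convex_stdSimplex ℝ _ hz (single_mem_stdSimplex ℝ k) (sub_nonneg.2 hu.2) hu.1
      (by ring), i, hik, ?_⟩
    simp [w, hi, hik]
  refine ⟨fun a => F (w a), hF.comp hw.continuousOn fun a ha => hwmem _ ha.1 _ ha.2,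
    fun z _ => by simp [w], fun z hz u hu => hFq _ (hwmem z hz u (Ioc_subset_Icc_self hu)) ?_⟩
  refine (highSum_pos_iff (hwmem z hz u (Ioc_subset_Icc_self hu)).1.1).2 ⟨k, hkm, ?_⟩
  have h1 := mul_nonneg (sub_nonneg.2 hu.2) (hz.1.1 k)
  simp only [w, Pi.add_apply, Pi.smul_apply, Pi.single_eq_same, smul_eq_mul, mul_one]
  linarith [hu.1]

variable [PartialOrder P] [TopologicalSpace.MetrizableSpace X] {J : Fin (n + 1) → P}

theorem HasPushOff.step (hJ : Monotone J)
    (hπ : ∀ p q : P, p < q → IsSerreFibration (pairHolinkEv0 s p q)) (hk : 0 < k)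
    (hF : ContinuousOn F (stdHorn k))
    (hFJ : ∀ z ∈ stdHorn k, ∀ j, 0 < z j → (∀ i, j < i → z i = 0) → s (F z) = J j)
    {m : Fin (n + 1)} (hmn : m < Fin.last n) (h : HasPushOff s (J (Fin.last n)) k F (highSum m)) :
    HasPushOff s (J (Fin.last n)) k F fun z => z m + highSum m z := by
  obtain ⟨h, hh, hh0, hhθ, hhq⟩ := h
  have hhs := continuous_highSum (n := n) m
  have hF' : ContinuousOn (fun z => h (z, 1)) (stdHorn k) :=
    hh.comp (by fun_prop) fun z hz => ⟨hz, right_mem_Icc.2 zero_le_one⟩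
  have hFq : ∀ z ∈ stdHorn k, 0 < highSum m z → s (h (z, 1)) = J (Fin.last n) :=
    fun z hz hz0 => hhq z hz hz0 1 (right_mem_Ioc.2 zero_lt_one)
  have hFp : ∀ z ∈ stdHorn k, 0 < z m → highSum m z = 0 → s (h (z, 1)) = J m := by
    intro z hz hzm hz0
    rw [hhθ z hz hz0 1 (right_mem_Icc.2 zero_le_one)]
    exact hFJ z hz m hzm ((highSum_eq_zero_iff hz.1.1).1 hz0)
  have hκ : ∃ κ : (Fin (n + 1) → ℝ) × ℝ → X,
      ContinuousOn κ ({z ∈ stdHorn k | 0 < z m + highSum m z} ×ˢ Icc 0 1) ∧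
      (∀ z ∈ stdHorn k, 0 < z m + highSum m z → κ (z, 0) = h (z, 1)) ∧
      ∀ z ∈ stdHorn k, 0 < z m + highSum m z → ∀ u ∈ Ioc (0 : ℝ) 1,
        s (κ (z, u)) = J (Fin.last n) := by
    rcases (hJ (Fin.le_last m)).eq_or_lt with hJm | hJm
    · refine ⟨fun a => h (a.1, 1), hF'.comp continuousOn_fst fun a ha => ha.1.1, fun _ _ _ => rfl,
        fun z hz h0 u _ => ?_⟩
      rcases (highSum_nonneg hz.1.1).eq_or_lt with h1 | h1
      · rw [← hJm]
        exact hFp z hz (by linarith) h1.symm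
      · exact hFq z hz h1
    · rcases le_or_gt k m with hkm | hkm
      · exact (hπ _ _ hJm).exists_homotopy_star hk hkm hmn hF' hFp hFq
      · obtain ⟨κ, h1, h2, h3⟩ := exists_homotopy_star_of_lt hkm hF' hFq
        exact ⟨κ, h1.mono (prod_mono_left fun z hz => hz.1), fun z hz _ => h2 z hz,
          fun z hz _ => h3 z hz⟩
  obtain ⟨κ, hκ, hκ0, hκq⟩ := hκ
  obtain ⟨h', h1, h2, h3⟩ := exists_concat_homotopy (δ := highSum m)
    (D := {z ∈ stdHorn k | 0 < z m + highSum m z}) (fun z hz => hz.1) hhs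
    (fun z hz => highSum_nonneg hz.1.1) hh hh0 hhθ hhq hκ (fun z hz => hκ0 z hz.1 hz.2)
    fun z hz => hκq z hz.1 hz.2
  exact exists_damped_homotopy hF (by fun_prop)
    (fun z hz => add_nonneg (hz.1.1 m) (highSum_nonneg hz.1.1)) h1
    (fun z hz hz0 => h2 z ⟨hz, hz0⟩) fun z hz hz0 => h3 z ⟨hz, hz0⟩

lemma highSum_castSucc {n : ℕ} (i : Fin n) (z : Fin (n + 1) → ℝ) :
    highSum i.castSucc z = z i.succ + highSum i.succ z := by
  have h : Finset.Ioi i.castSucc = insert i.succ (Finset.Ioi i.succ) := by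
    ext j
    simp only [Finset.mem_Ioi, Finset.mem_insert, Fin.lt_def, Fin.ext_iff, Fin.val_succ,
      Fin.val_castSucc]
    omega
  rw [highSum, h, Finset.sum_insert (by simp), highSum]

theorem exists_pushOff (hJ : Monotone J)
    (hπ : ∀ p q : P, p < q → IsSerreFibration (pairHolinkEv0 s p q)) (hk : 0 < k)
    (hF : ContinuousOn F (stdHorn k))
    (hFJ : ∀ z ∈ stdHorn k, ∀ j, 0 < z j → (∀ i, j < i → z i = 0) → s (F z) = J j) :
    ∃ h : (Fin (n + 1) → ℝ) × ℝ → X, ContinuousOn h (stdHorn k ×ˢ Icc 0 1) ∧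
      (∀ z ∈ stdHorn k, h (z, 0) = F z) ∧
      ∀ z ∈ stdHorn k, ∀ u ∈ Ioc (0 : ℝ) 1, s (h (z, u)) = J (Fin.last n) := by
  have hP : ∀ m : Fin (n + 1),
      HasPushOff s (J (Fin.last n)) k F fun z => z m + highSum m z := by
    intro m
    induction m using Fin.reverseInduction with
    | last =>
      refine ⟨fun a => F a.1, hF.comp continuousOn_fst fun a ha => ha.1, fun _ _ => rfl,
        fun _ _ _ _ _ => rfl, fun z hz h0 u _ => ?_⟩
      have h1 : highSum (Fin.last n) z = 0 :=
        (highSum_eq_zero_iff hz.1.1).2 fun i hi => absurd hi (Fin.le_last i).not_gt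
      exact hFJ z hz _ (by linarith) fun i hi => absurd hi (Fin.le_last i).not_gt
    | cast i ih =>
      refine HasPushOff.step hJ hπ hk hF hFJ (Fin.castSucc_lt_last i) ?_
      simpa only [← highSum_castSucc] using ih
  obtain ⟨h, h1, h2, -, h3⟩ := hP 0
  refine ⟨h, h1, h2, fun z hz => h3 z hz ?_⟩
  have h4 := sum_eq_lowSum_add_highSum 0 z
  have h5 : lowSum 0 z = 0 :=
    Finset.sum_eq_zero fun i hi => absurd (Finset.mem_Iio.1 hi) (Fin.zero_le i).not_gt
  rw [hz.1.2, h5] at h4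
  linarith

end PushOff

/-- Over a metrizable stratified space whose pairwise homotopy links are Serre fibrations, inner
stratified horns may be filled. -/
theorem HornFilling.of_isSerreFibration {P X : Type*} [PartialOrder P] [TopologicalSpace X]
    [TopologicalSpace.MetrizableSpace X] {s : X → P} {n : ℕ} {J : Fin (n + 1) → P}
    {k : Fin (n + 1)} (hJ : Monotone J)
    (hπ : ∀ p q : P, p < q → IsSerreFibration (pairHolinkEv0 s p q)) (hk : 0 < k)
    (hkn : k < Fin.last n) : HornFilling s J k := by
  classical
  intro f hf hfs
  let x₀ : X := f ⟨⟨Pi.single k 1, single_mem_stdSimplex ℝ k⟩, 0, hk.ne, by simp [hk.ne]⟩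
  let F : (Fin (n + 1) → ℝ) → X := fun z =>
    if hz : z ∈ stdHorn k then f ⟨⟨z, hz.1⟩, hz.2⟩ else x₀
  have hFf : ∀ z (hz : z ∈ stdHorn k), F z = f ⟨⟨z, hz.1⟩, hz.2⟩ := fun z hz => dif_pos hz
  have hF : ContinuousOn F (stdHorn k) := by
    rw [continuousOn_iff_continuous_domRestrict]
    have h1 : Continuous fun z : stdHorn k => f ⟨⟨z.1, z.2.1⟩, z.2.2⟩ :=
      hf.comp ((continuous_subtype_val.subtype_mk _).subtype_mk _)
    exact h1.congr fun z => (hFf z.1 z.2).symm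
  obtain ⟨h, hh, hh0, hhq⟩ := exists_pushOff hJ hπ hk hF fun z hz j hj hij => by
    rw [hFf z hz, hfs, flagStrat, maxSupp_eq hj hij]
  have hne : (Finset.univ.erase k).Nonempty := ⟨0, by simp [hk.ne]⟩
  let τ : (Fin (n + 1) → ℝ) → ℝ := fun z => (Finset.univ.erase k).inf' hne z
  have hτ : Continuous τ := Continuous.finset_inf'_apply hne fun i _ => continuous_apply i
  have hτle : ∀ z i, i ≠ k → τ z ≤ z i := fun z i hi =>
    Finset.inf'_le z (Finset.mem_erase.2 ⟨hi, Finset.mem_univ i⟩)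
  have hτeq : ∀ z, ∃ i, i ≠ k ∧ τ z = z i := fun z => by
    obtain ⟨i, hi, h1⟩ := Finset.exists_mem_eq_inf' hne z
    exact ⟨i, (Finset.mem_erase.1 hi).1, h1⟩
  have hτ0 : ∀ z ∈ stdSimplex ℝ (Fin (n + 1)), 0 ≤ τ z := fun z hz => by
    obtain ⟨i, -, h1⟩ := hτeq z
    exact h1 ▸ hz.1 i
  have hτ1 : ∀ z ∈ stdSimplex ℝ (Fin (n + 1)), τ z ≤ 1 := fun z hz =>
    (hτle z 0 hk.ne).trans (mem_Icc_of_mem_stdSimplex hz 0).2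
  let r : (Fin (n + 1) → ℝ) → Fin (n + 1) → ℝ := fun z =>
    z + τ z • (((n : ℝ) + 1) • Pi.single k 1 - 1)
  have hr : Continuous r := by fun_prop
  have hrne : ∀ z i, i ≠ k → r z i = z i - τ z := fun z i hi => by
    simp [r, hi]
    ring
  have hrk : ∀ z, r z k = z k + τ z * n := fun z => by simp [r]
  have hrmem : ∀ z ∈ stdSimplex ℝ (Fin (n + 1)), r z ∈ stdHorn k := by
    refine fun z hz => ⟨⟨fun i => ?_, ?_⟩, ?_⟩
    · rcases eq_or_ne i k with rfl | hi
      · rw [hrk]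
        exact add_nonneg (hz.1 i) (mul_nonneg (hτ0 z hz) n.cast_nonneg)
      · rw [hrne z i hi]
        exact sub_nonneg.2 (hτle z i hi)
    · simp [r, Finset.sum_add_distrib, ← Finset.mul_sum, hz.2]
    · obtain ⟨i, hi, h1⟩ := hτeq z
      exact ⟨i, hi, by rw [hrne z i hi, h1, sub_self]⟩
  have hhorn : ∀ y : hornSet n k, h (r y.1.1, τ y.1.1) = f y := by
    rintro ⟨⟨z, hz⟩, hy⟩
    obtain ⟨i, hi, h1⟩ := id hy
    have h2 : τ z = 0 := le_antisymm ((hτle z i hi).trans_eq h1) (hτ0 z hz)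
    have h3 : r z = z := by simp [r, h2]
    simp only [h2, h3]
    rw [hh0 z ⟨hz, hy⟩, hFf z ⟨hz, hy⟩]
  refine ⟨fun x => h (r x.1, τ x.1), ?_, fun x => ?_, hhorn⟩
  · exact hh.comp_continuous ((hr.comp continuous_subtype_val).prodMk
      (hτ.comp continuous_subtype_val)) fun x => ⟨hrmem x.1 x.2, hτ0 x.1 x.2, hτ1 x.1 x.2⟩
  · rcases (hτ0 x.1 x.2).eq_or_lt with h1 | h1
    · obtain ⟨i, hi, h2⟩ := hτeq x.1
      have hx : x ∈ hornSet n k := ⟨i, hi, h2.symm.trans h1.symm⟩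
      exact (congrArg s (hhorn ⟨x, hx⟩)).trans (hfs ⟨x, hx⟩)
    · rw [hhq _ (hrmem x.1 x.2) _ ⟨h1, hτ1 x.1 x.2⟩, flagStrat,
        maxSupp_eq (h1.trans_le (hτle x.1 _ hkn.ne'))
          fun i hi => absurd hi (Fin.le_last i).not_gt]

/-- **Equivalent characterizations of fibrancy** for a metrizable stratified space:
categorical fibrancy, diagrammatic fibrancy, the pairwise homotopy links being Serre
fibrations over the strata, and horn filling for the degenerate two-element flags
`[p = ⋯ = p < q = ⋯ = q]`. -/
theorem equivalence_of_fibrancy {P : Type} [PartialOrder P] {X : Type} [TopologicalSpace X]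
    [TopologicalSpace.MetrizableSpace X] (s : X → P) (hs : AlexContinuous s) :
    List.TFAE
      [CatFibrant s,
       DiagFibrant s,
       ∀ p q : P, p < q → IsSerreFibration (pairHolinkEv0 s p q),
       ∀ p q : P, p < q → ∀ n k : ℕ, ∀ _hk1 : 1 ≤ k, ∀ hkn : k < n,
         HornFilling s (fun i : Fin (n + 1) => if (i : ℕ) ≤ k then p else q)
           ⟨k, by omega⟩] := by
  tfae_have 1 → 2 := CatFibrant.diagFibrant
  tfae_have 2 → 1 := fun h n J hJ k hk => h n J hJ k (Or.inl hk)
  tfae_have 1 → 4 := by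
    refine fun h p q hpq n k hk1 hkn => h n _ (fun i j hij => ?_) _ ⟨hk1, hkn⟩
    have hij' : (i : ℕ) ≤ j := hij
    split_ifs <;> first | exact le_rfl | exact hpq.le | omega
  tfae_have 4 → 3 := fun h p q hpq => isSerreFibration_of_hornFilling fun m =>
    h p q hpq (m + 2) (m + 1) (by omega) (by omega)
  tfae_have 3 → 1 := fun h n J hJ k hk =>
    HornFilling.of_isSerreFibration hJ h (Fin.lt_def.2 hk.1) (Fin.lt_def.2 hk.2)
  tfae_finish
end
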